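/- arXiv:2508.04083 — 3 statements merged into one kernel-verified Lean document; each statement's English description precedes it below -/
import Mathlib

section
/- Let G be a finite simple graph with independence number 3, let a₁ be the number of vertices of G, a₂ the number of 2-element independent sets, and a₃ the number of 3-element independent sets, and let P(z) = a₁z + a₂z² + a₃z³ as a map ℂ → ℂ. Suppose a₁ ≥ 4 and a₂²·(a₁ − 2) = a₃·(2a₁ − 3)². Then: if a₁ ≤ 6 the Julia set J(P) is connected, and if a₁ > 6 the Julia set J(P) is not connected but is not totally disconnected (it contains a connected subset with at least two distinct points). -/
open Set Topology

theorem preconnectedSpace_of_isOpenMap_isClosedMap {X Y : Type*} [TopologicalSpace X]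
    [TopologicalSpace Y] [PreconnectedSpace Y] {g : X → Y} (ho : IsOpenMap g) (hc : IsClosedMap g)
    {w : Y} {I : Set X} (hI : IsPreconnected I) (hwI : g ⁻¹' {w} ⊆ I) : PreconnectedSpace X := by
  have key : ∀ S : Set X, IsClopen S → S.Nonempty → ∃ x ∈ S, g x = w := fun S hS hne =>
    (eq_univ_iff_forall.1 (IsClopen.eq_univ ⟨hc _ hS.1, ho _ hS.2⟩ (hne.image g))) w
  have hsub : ∀ S : Set X, IsClopen S → S.Nonempty → I ⊆ S := by
    intro S hS hne
    obtain ⟨x, hx, hxw⟩ := key S hS hne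
    exact hI.subset_isClopen hS ⟨x, hwI hxw, hx⟩
  rw [preconnectedSpace_iff_clopen]
  intro S hS
  by_contra! h
  obtain ⟨x, hx, hxw⟩ := key S hS h.1
  exact hsub Sᶜ hS.compl (nonempty_compl.2 h.2) (hwI hxw) hx

theorem IsPreconnected.preimage_of_isOpenMap_isClosedMap {X Y : Type*} [TopologicalSpace X]
    [TopologicalSpace Y] {f : X → Y} (ho : IsOpenMap f) (hc : IsClosedMap f)
    {C : Set Y} (hC : IsPreconnected C) {w : Y} (hw : w ∈ C) {I : Set X} (hI : IsPreconnected I)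
    (hwI : f ⁻¹' {w} ⊆ I) (hIC : I ⊆ f ⁻¹' C) : IsPreconnected (f ⁻¹' C) := by
  have := isPreconnected_iff_preconnectedSpace.1 hC
  rw [isPreconnected_iff_preconnectedSpace]
  refine preconnectedSpace_of_isOpenMap_isClosedMap (g := C.restrictPreimage f)
    (ho.restrictPreimage C) (hc.restrictPreimage C) (w := ⟨w, hw⟩)
    (I := Subtype.val ⁻¹' I) ?_ ?_
  · rw [← IsInducing.subtypeVal.isPreconnected_image, Subtype.image_preimage_coe,
      inter_eq_right.2 hIC]
    exact hI
  · rintro ⟨x, hx⟩ h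
    exact hwI (by simpa [Subtype.ext_iff] using h)

theorem isPreconnected_iInter_of_antitone {X : Type*} [TopologicalSpace X] [T2Space X]
    {C : ℕ → Set X} (hanti : Antitone C) (hcomp : ∀ n, IsCompact (C n))
    (hconn : ∀ n, IsPreconnected (C n)) : IsPreconnected (⋂ n, C n) := by
  have hK : IsCompact (⋂ n, C n) :=
    (hcomp 0).of_isClosed_subset (isClosed_iInter fun n => (hcomp n).isClosed) (iInter_subset C 0)
  rw [isPreconnected_iff_subset_of_fully_disjoint_closed hK.isClosed]
  intro M N hM hN hsub hdis
  obtain ⟨U, V, hU, hV, hMU, hNV, hUV⟩ := SeparatedNhds.of_isCompact_isCompact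
    (hK.inter_right hM) (hK.inter_right hN) (hdis.mono inter_subset_right inter_subset_right)
  obtain ⟨n, hn⟩ : ∃ n, C n ⊆ U ∪ V := by
    refine exists_subset_nhds_of_isCompact (directed_of_isDirected_le hanti) hcomp fun x hx =>
      (hU.union hV).mem_nhds ?_
    exact (hsub hx).imp (fun h => hMU ⟨hx, h⟩) fun h => hNV ⟨hx, h⟩
  refine (isPreconnected_iff_subset_of_disjoint.1 (hconn n) U V hU hV hn
    (by rw [hUV.inter_eq, inter_empty])).imp (fun h x hx => ?_) fun h x hx => ?_
  · exact (hsub hx).resolve_right fun hxN =>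
      disjoint_left.1 hUV (h (mem_iInter.1 hx n)) (hNV ⟨hx, hxN⟩)
  · exact (hsub hx).resolve_left fun hxM =>
      disjoint_left.1 hUV (hMU ⟨hx, hxM⟩) (h (mem_iInter.1 hx n))

theorem IsPreconnected.inter_of_isClosed_of_union_eq_univ {X : Type*} [TopologicalSpace X]
    [NormalSpace X] [SimplyConnectedSpace X] [LocallyPathConnectedSpace X] {A B : Set X}
    (hA : IsPreconnected A) (hB : IsPreconnected B) (hAc : IsClosed A) (hBc : IsClosed B)
    (hAB : A ∪ B = univ) : IsPreconnected (A ∩ B) := by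
  classical
  rw [isPreconnected_iff_subset_of_fully_disjoint_closed (hAc.inter hBc)]
  intro M N hM hN hsub hdis
  by_contra! h
  obtain ⟨⟨p, hp, hpM⟩, ⟨q, hq, hqN⟩⟩ := And.intro (not_subset.1 h.1) (not_subset.1 h.2)
  have hpN : p ∈ N := (hsub hp).resolve_left hpM
  have hqM : q ∈ M := (hsub hq).resolve_right hqN
  obtain ⟨u, hu0, hu1, -⟩ := exists_continuous_zero_one_of_isClosed hM hN hdis
  let θ : X → ℝ := fun x => Real.pi * u x
  have hθ : Continuous θ := by fun_prop
  let g : X → ℂ := fun x =>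
    if x ∈ A then Complex.exp (θ x * Complex.I) else Complex.exp (-(θ x * Complex.I))
  have hgA : ∀ x ∈ A, g x = Complex.exp (θ x * Complex.I) := fun x hx => by simp [g, hx]
  have hgB : ∀ x ∈ B, g x = Complex.exp (-(θ x * Complex.I)) := by
    intro x hx
    by_cases hxA : x ∈ A
    · rw [hgA x hxA]
      rcases hsub ⟨hxA, hx⟩ with hx' | hx'
      · simp [θ, hu0 hx']
      · simp [θ, hu1 hx', Complex.exp_neg]
    · simp [g, hxA]
  have hg : ContinuousOn g univ := by
    rw [← hAB]
    refine ContinuousOn.union_of_isClosed ?_ ?_ hAc hBc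
    · exact (Continuous.continuousOn (by fun_prop)).congr hgA
    · exact (Continuous.continuousOn (by fun_prop)).congr hgB
  have hg0 : ∀ x, g x ≠ 0 := by
    intro x
    simp only [g]
    split_ifs <;> exact Complex.exp_ne_zero _
  obtain ⟨L, ⟨-, hLg⟩, -⟩ := Complex.isCoveringMapOn_exp.existsUnique_continuousMap_lifts
    (⟨g, continuousOn_univ.1 hg⟩ : C(X, ℂ)) (a₀ := p) (Complex.exp_log (hg0 p)) hg0
  have hLg : ∀ x, Complex.exp (L x) = g x := fun x => congrFun hLg x
  have hconst : ∀ (S : Set X) (F : X → ℂ), IsPreconnected S → Continuous F →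
      (∀ x ∈ S, Complex.exp (F x) = 1) → ∀ x ∈ S, ∀ y ∈ S, F x = F y := by
    intro S F hS hF h1 x hx y hy
    refine Complex.isCoveringMap_exp.constOn_of_comp hS hF.continuousOn ?_ hx hy
    intro a ha a' ha'
    simp [h1 a ha, h1 a' ha']
  have h1 := hconst A (fun x => L x - θ x * Complex.I) hA (by fun_prop) (by
    intro x hx
    rw [Complex.exp_sub, hLg, hgA x hx, div_self (Complex.exp_ne_zero _)]) p hp.1 q hq.1
  have h2 := hconst B (fun x => L x + θ x * Complex.I) hB (by fun_prop) (by
    intro x hx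
    rw [Complex.exp_add, hLg, hgB x hx, ← Complex.exp_add]
    simp) p hp.2 q hq.2
  have h3 : θ p = Real.pi := by simp [θ, hu1 hpN]
  have h4 : θ q = 0 := by simp [θ, hu0 hqM]
  simp only [h3, h4, Complex.ofReal_zero] at h1 h2
  have h5 : (Real.pi : ℂ) * Complex.I = 0 := by linear_combination (h2 - h1) / 2
  simp [Real.pi_ne_zero] at h5

theorem isPreconnected_compl_connectedComponentIn_compl {X : Type*} [TopologicalSpace X]
    [PreconnectedSpace X] [LocallyConnectedSpace X] {Q : Set X} (hQ : IsPreconnected Q)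
    (hQc : IsClosed Q) (hQn : Q.Nonempty) (x : X) :
    IsPreconnected (connectedComponentIn Qᶜ x)ᶜ := by
  set W := connectedComponentIn Qᶜ x with hW
  have hWo : IsOpen W := hQc.isOpen_compl.connectedComponentIn
  have hQW : Q ⊆ Wᶜ := subset_compl_comm.1 (connectedComponentIn_subset _ _)
  rw [isPreconnected_iff_subset_of_fully_disjoint_closed hWo.isClosed_compl]
  have key : ∀ S T : Set X, IsClosed S → IsClosed T → Wᶜ ⊆ S ∪ T → Disjoint S T → Q ⊆ S →
      Wᶜ ⊆ S := by
    intro S T hS hT hST hdis hQS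
    have hclopen : IsClopen (Wᶜ ∩ T) := by
      refine ⟨hWo.isClosed_compl.inter hT, isOpen_iff_mem_nhds.2 fun y hy => ?_⟩
      have hyQ : y ∈ Qᶜ := fun h => disjoint_left.1 hdis (hQS h) hy.2
      have hyo : IsOpen (connectedComponentIn Qᶜ y) := hQc.isOpen_compl.connectedComponentIn
      refine Filter.mem_of_superset (hyo.mem_nhds (mem_connectedComponentIn hyQ)) ?_
      have hsub : connectedComponentIn Qᶜ y ⊆ Wᶜ := by
        intro z hz hzW
        rw [hW, connectedComponentIn_eq hzW, ← connectedComponentIn_eq hz] at hy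
        exact hy.1 (mem_connectedComponentIn hyQ)
      refine subset_inter hsub ?_
      have h := (isPreconnected_iff_subset_of_disjoint_closed.1
        (isPreconnected_connectedComponentIn (F := Qᶜ) (x := y))) S T hS hT (hsub.trans hST)
        (by rw [hdis.inter_eq, inter_empty])
      refine h.resolve_left fun h => disjoint_left.1 hdis (h (mem_connectedComponentIn hyQ)) hy.2
    rcases isClopen_iff.1 hclopen with h | h
    · intro y hy
      refine (hST hy).resolve_right fun hyT => ?_
      exact (h ▸ (⟨hy, hyT⟩ : y ∈ Wᶜ ∩ T) : y ∈ (∅ : Set X))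
    · obtain ⟨q, hq⟩ := hQn
      exact (disjoint_left.1 hdis (hQS hq) (h.symm ▸ mem_univ q : q ∈ Wᶜ ∩ T).2).elim
  intro S T hS hT hST hdis
  rcases isPreconnected_iff_subset_of_disjoint_closed.1 hQ S T hS hT (hQW.trans hST)
    (by rw [hdis.inter_eq, inter_empty]) with h | h
  · exact .inl (key S T hS hT hST hdis h)
  · exact .inr (key T S hT hS (union_comm S T ▸ hST) hdis.symm h)

theorem isPreconnected_frontier_of_compl {X : Type*} [TopologicalSpace X]
    [NormalSpace X] [SimplyConnectedSpace X] [LocallyPathConnectedSpace X] {W : Set X}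
    (hW : IsPreconnected W) (hW' : IsPreconnected Wᶜ) : IsPreconnected (frontier W) := by
  rw [frontier_eq_closure_inter_closure]
  refine hW.closure.inter_of_isClosed_of_union_eq_univ hW'.closure isClosed_closure
    isClosed_closure ?_
  exact eq_univ_of_subset (union_subset_union subset_closure subset_closure) (union_compl_self W)

theorem frontier_connectedComponentIn_compl_subset {X : Type*} [TopologicalSpace X]
    [LocallyConnectedSpace X] {Q : Set X} (hQc : IsClosed Q) (x : X) :
    frontier (connectedComponentIn Qᶜ x) ⊆ frontier Q := by
  intro y hy
  set W := connectedComponentIn Qᶜ x with hW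
  have hWo : IsOpen W := hQc.isOpen_compl.connectedComponentIn
  have hyW : y ∉ W := by rw [hWo.frontier_eq] at hy; exact hy.2
  have hyQ : y ∈ Q := by
    by_contra hyQ
    have hyo : IsOpen (connectedComponentIn Qᶜ y) := hQc.isOpen_compl.connectedComponentIn
    obtain ⟨z, hz, hzW⟩ := mem_closure_iff.1 hy.1 _ hyo (mem_connectedComponentIn hyQ)
    rw [hW, connectedComponentIn_eq hzW, ← connectedComponentIn_eq hz] at hyW
    exact hyW (mem_connectedComponentIn hyQ)
  rw [frontier_eq_closure_inter_closure]
  exact ⟨subset_closure hyQ, closure_mono (connectedComponentIn_subset _ _) hy.1⟩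

theorem frontier_connectedComponentIn_subset {X : Type*} [TopologicalSpace X]
    [LocallyConnectedSpace X] {K : Set X} (hK : IsClosed K) (x : X) :
    frontier (connectedComponentIn K x) ⊆ frontier K := by
  intro y hy
  rw [hK.frontier_eq]
  by_cases hx : x ∈ K
  swap
  · simp [connectedComponentIn_eq_empty hx] at hy
  have hyQ : y ∈ connectedComponentIn K x := by
    have h1 : closure (connectedComponentIn K x) ⊆ K :=
      closure_minimal (connectedComponentIn_subset K x) hK
    exact isPreconnected_connectedComponentIn.closure.subset_connectedComponentIn
      (subset_closure (mem_connectedComponentIn hx)) h1 hy.1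
  refine ⟨connectedComponentIn_subset K x hyQ, fun hyi => hy.2 ?_⟩
  rw [mem_interior_iff_mem_nhds, connectedComponentIn_eq hyQ]
  exact connectedComponentIn_mem_nhds (mem_interior_iff_mem_nhds.1 hyi)

theorem IsPreconnected.inter_frontier_nonempty_of_inter {X : Type*} [TopologicalSpace X]
    {S W : Set X} (hS : IsPreconnected S) (h : (S ∩ W).Nonempty) (h' : (S ∩ Wᶜ).Nonempty) :
    (S ∩ frontier W).Nonempty := by
  rw [frontier_eq_closure_inter_closure]
  refine isPreconnected_closed_iff.1 hS _ _ isClosed_closure isClosed_closure ?_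
    (h.mono (inter_subset_inter_right _ subset_closure))
    (h'.mono (inter_subset_inter_right _ subset_closure))
  intro x _
  exact (em (x ∈ W)).imp (fun h => subset_closure h) fun h => subset_closure h

/-- A compact plane set with an interior point has a nondegenerate connected subset in its
frontier. -/
theorem exists_nontrivial_isPreconnected_subset_frontier {K : Set ℂ} (hK : IsCompact K)
    (hint : (interior K).Nonempty) :
    ∃ t ⊆ frontier K, IsPreconnected t ∧ t.Nontrivial := by
  obtain ⟨c, hc⟩ := hint
  have hcK : c ∈ K := interior_subset hc
  set Q := connectedComponentIn K c with hQ
  have hcQ : c ∈ Q := mem_connectedComponentIn hcK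
  have hQn : Q ∈ 𝓝 c := connectedComponentIn_mem_nhds (mem_interior_iff_mem_nhds.1 hc)
  have hQK : Q ⊆ K := connectedComponentIn_subset K c
  have hQc : IsClosed Q := by
    refine closure_subset_iff_isClosed.1 ?_
    exact isPreconnected_connectedComponentIn.closure.subset_connectedComponentIn
      (subset_closure hcQ) (closure_minimal hQK hK.isClosed)
  obtain ⟨x, hx⟩ : Qᶜ.Nonempty := by
    rw [nonempty_compl]
    intro h
    exact noncompact_univ ℂ (hK.of_isClosed_subset isClosed_univ (h ▸ hQK))
  set W := connectedComponentIn Qᶜ x with hW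
  have hWo : IsOpen W := hQc.isOpen_compl.connectedComponentIn
  have hxW : x ∈ W := mem_connectedComponentIn hx
  refine ⟨frontier W, (frontier_connectedComponentIn_compl_subset hQc x).trans
    (frontier_connectedComponentIn_subset hK.isClosed c),
    isPreconnected_frontier_of_compl isPreconnected_connectedComponentIn
      (isPreconnected_compl_connectedComponentIn_compl isPreconnected_connectedComponentIn hQc
        ⟨c, hcQ⟩ x), ?_⟩
  have key : ∀ p : ℂ, ({p}ᶜ ∩ frontier W).Nonempty := by
    intro p
    have hnt : ∀ S : Set ℂ, ∀ y, S ∈ 𝓝 y → ({p}ᶜ ∩ S).Nonempty := by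
      intro S y hS
      obtain ⟨z, hz, hzp⟩ := (infinite_of_mem_nhds y hS).exists_notMem_finite (finite_singleton p)
      exact ⟨z, hzp, hz⟩
    refine (isConnected_compl_singleton_of_one_lt_rank (by simp)
      p).isPreconnected.inter_frontier_nonempty_of_inter (hnt W x (hWo.mem_nhds hxW)) ?_
    exact (hnt Q c hQn).mono (inter_subset_inter_right _
      (subset_compl_comm.1 (connectedComponentIn_subset _ _)))
  obtain ⟨p, -, hp⟩ := key 0
  obtain ⟨q, hqp, hq⟩ := key p
  exact ⟨q, hq, p, hp, hqp⟩

open Bornology Metric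

/-- The set of points whose forward orbit under `f` is bounded. -/
def filledJulia (f : ℂ → ℂ) : Set ℂ := {z | IsBounded (range fun n => f^[n] z)}

theorem mem_filledJulia {f : ℂ → ℂ} {z : ℂ} :
    z ∈ filledJulia f ↔ ∃ C : ℝ, ∀ n, ‖f^[n] z‖ ≤ C := by
  simp [filledJulia, isBounded_iff_forall_norm_le]

theorem apply_mem_filledJulia_iff {f : ℂ → ℂ} {z : ℂ} :
    f z ∈ filledJulia f ↔ z ∈ filledJulia f := by
  simp only [mem_filledJulia]
  constructor
  · rintro ⟨C, hC⟩
    refine ⟨max C ‖z‖, fun n => ?_⟩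
    cases n with
    | zero => simp
    | succ n => exact (hC n).trans (le_max_left _ _)
  · rintro ⟨C, hC⟩
    exact ⟨C, fun n => hC (n + 1)⟩

theorem notMem_filledJulia_of_pow_le {f : ℂ → ℂ} {z : ℂ} {δ : ℝ} (hδ : 0 < δ)
    (h : ∀ n, 2 ^ n * δ ≤ ‖f^[n] z‖) : z ∉ filledJulia f := by
  rw [mem_filledJulia]
  rintro ⟨C, hC⟩
  obtain ⟨n, hn⟩ := pow_unbounded_of_one_lt (C / δ) (one_lt_two (α := ℝ))
  rw [div_lt_iff₀ hδ] at hn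
  linarith [h n, hC n]

section Escape

variable {f : ℂ → ℂ} {R : ℝ}

theorem antitone_preimage_iterate_closedBall (hR : 0 ≤ R)
    (hf : ∀ z, R < ‖z‖ → 2 * ‖z‖ ≤ ‖f z‖) :
    Antitone fun n => f^[n] ⁻¹' closedBall 0 R := by
  refine antitone_nat_of_succ_le fun n z hz => ?_
  simp only [mem_preimage, mem_closedBall_zero_iff, Function.iterate_succ_apply'] at hz ⊢
  by_contra! h
  linarith [hf _ h]

theorem filledJulia_eq_iInter (hR : 0 ≤ R) (hf : ∀ z, R < ‖z‖ → 2 * ‖z‖ ≤ ‖f z‖) :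
    filledJulia f = ⋂ n, f^[n] ⁻¹' closedBall 0 R := by
  ext z
  simp only [mem_iInter, mem_preimage, mem_closedBall_zero_iff]
  refine ⟨fun hz n => ?_, fun h => mem_filledJulia.2 ⟨R, h⟩⟩
  by_contra! hn
  have hmem : f^[n] z ∈ filledJulia f := by
    obtain ⟨C, hC⟩ := mem_filledJulia.1 hz
    refine mem_filledJulia.2 ⟨C, fun m => ?_⟩
    rw [← Function.iterate_add_apply]
    exact hC _
  refine notMem_filledJulia_of_pow_le (hR.trans_lt hn) (fun m => ?_) hmem
  induction m with
  | zero => simp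
  | succ m ih =>
    rw [Function.iterate_succ_apply']
    have h1 : ‖f^[n] z‖ ≤ 2 ^ m * ‖f^[n] z‖ :=
      le_mul_of_one_le_left (norm_nonneg _) (one_le_pow₀ one_le_two)
    have := hf (f^[m] (f^[n] z)) (by linarith)
    rw [pow_succ']
    linarith

theorem isCompact_preimage_iterate_closedBall (hc : Continuous f) (hR : 0 ≤ R)
    (hf : ∀ z, R < ‖z‖ → 2 * ‖z‖ ≤ ‖f z‖) (n : ℕ) :
    IsCompact (f^[n] ⁻¹' closedBall 0 R) :=
  (isCompact_closedBall (0 : ℂ) R).of_isClosed_subset (isClosed_closedBall.preimage (hc.iterate n))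
    (antitone_preimage_iterate_closedBall hR hf n.zero_le)

theorem isCompact_filledJulia (hc : Continuous f) (hR : 0 ≤ R)
    (hf : ∀ z, R < ‖z‖ → 2 * ‖z‖ ≤ ‖f z‖) : IsCompact (filledJulia f) := by
  rw [filledJulia_eq_iInter hR hf]
  exact (isCompact_preimage_iterate_closedBall hc hR hf 0).of_isClosed_subset
    (isClosed_iInter fun n => (isCompact_preimage_iterate_closedBall hc hR hf n).isClosed)
    (iInter_subset _ 0)

theorem isPreconnected_filledJulia (hc : Continuous f) (ho : IsOpenMap f) (hcl : IsClosedMap f)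
    (hR : 0 ≤ R) (hf : ∀ z, R < ‖z‖ → 2 * ‖z‖ ≤ ‖f z‖) {I : Set ℂ} (hI : IsPreconnected I)
    (hIR : I ⊆ closedBall 0 R) (hIf : MapsTo f I I) {w : ℂ} (hw : w ∈ I) (hwI : f ⁻¹' {w} ⊆ I) :
    IsPreconnected (filledJulia f) := by
  rw [filledJulia_eq_iInter hR hf]
  have hIn : ∀ n, I ⊆ f^[n] ⁻¹' closedBall 0 R := fun n x hx => hIR (hIf.iterate n hx)
  refine isPreconnected_iInter_of_antitone (antitone_preimage_iterate_closedBall hR hf)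
    (isCompact_preimage_iterate_closedBall hc hR hf) fun n => ?_
  induction n with
  | zero => exact (convex_closedBall (0 : ℂ) R).isPreconnected
  | succ n ih => exact ih.preimage_of_isOpenMap_isClosedMap ho hcl (hIn n hw) hI hwI (hIn (n + 1))

theorem isPreconnected_compl_closedBall_zero (hR : 0 < R) :
    IsPreconnected (closedBall (0 : ℂ) R)ᶜ := by
  have h : (closedBall (0 : ℂ) R)ᶜ = Complex.exp '' {z | Real.log R < z.re} := by
    ext z
    simp only [mem_compl_iff, mem_closedBall_zero_iff, not_le, mem_image, mem_ofPred_eq]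
    constructor
    · intro hz
      have hz0 : z ≠ 0 := norm_pos_iff.1 (hR.trans hz)
      refine ⟨Complex.log z, ?_, Complex.exp_log hz0⟩
      rw [Complex.log_re]
      exact Real.log_lt_log hR hz
    · rintro ⟨u, hu, rfl⟩
      rwa [Complex.norm_exp, ← Real.log_lt_iff_lt_exp hR]
  rw [h]
  exact (convex_halfSpace_re_gt _).isPreconnected.image _ Complex.continuous_exp.continuousOn

theorem isPreconnected_compl_filledJulia (ho : IsOpenMap f)
    (hcl : IsClosedMap f) (hR : 0 < R) (hf : ∀ z, R < ‖z‖ → 2 * ‖z‖ ≤ ‖f z‖) {w : ℂ}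
    (hw : R < ‖w‖) (hwR : ∀ z, f z = w → R < ‖z‖) : IsPreconnected (filledJulia f)ᶜ := by
  rw [filledJulia_eq_iInter hR.le hf, compl_iInter]
  have hanti := antitone_preimage_iterate_closedBall hR.le hf
  have hsub : ∀ n, (closedBall (0 : ℂ) R)ᶜ ⊆ (f^[n] ⁻¹' closedBall 0 R)ᶜ := fun n =>
    compl_subset_compl.2 (hanti n.zero_le)
  have hw' : w ∈ (closedBall (0 : ℂ) R)ᶜ := by simpa using hw
  refine isPreconnected_iUnion ⟨w, mem_iInter.2 fun n => hsub n hw'⟩ fun n => ?_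
  induction n with
  | zero => exact isPreconnected_compl_closedBall_zero hR
  | succ n ih =>
    exact ih.preimage_of_isOpenMap_isClosedMap ho hcl (hsub n hw')
      (isPreconnected_compl_closedBall_zero hR)
      (fun z hz => by simpa using hwR z hz) (hsub (n + 1))

end Escape

/-- The cubic polynomial with critical fixed point `0` and fixed points `1` and `-1 / b`. -/
def cubic (b : ℝ) (z : ℂ) : ℂ := b * z ^ 3 - (b - 1) * z ^ 2

section Cubic

variable {b : ℝ}

theorem cubic_ofReal (x : ℝ) : cubic b x = ((b * x ^ 3 - (b - 1) * x ^ 2 : ℝ) : ℂ) := by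
  simp [cubic]

theorem continuous_cubic : Continuous (cubic b) := by
  unfold cubic
  fun_prop

theorem cubic_eq_mul (z : ℂ) : cubic b z = z ^ 2 * (b * z - (b - 1 : ℝ)) := by
  simp only [cubic]
  push_cast
  ring

theorem isClosedMap_cubic : IsClosedMap (cubic b) := by
  open Polynomial in
  have h : cubic b = (C (b : ℂ) * X ^ 3 - C ((b : ℂ) - 1) * X ^ 2 : ℂ[X]).eval := by
    ext z
    simp [cubic]
  rw [h]
  exact Polynomial.isClosedMap_eval _

theorem isOpenMap_cubic : IsOpenMap (cubic b) := by
  have hd : Differentiable ℂ (cubic b) := by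
    unfold cubic
    fun_prop
  refine (AnalyticOnNhd.is_constant_or_isOpenMap
    fun z _ => hd.analyticAt z).resolve_left ?_
  rintro ⟨w, hw⟩
  have h := (hw 0).trans (hw 1).symm
  simp [cubic] at h

theorem two_mul_norm_le_norm_cubic (hb : 1 ≤ b) (z : ℂ) (hz : 2 < ‖z‖) :
    2 * ‖z‖ ≤ ‖cubic b z‖ := by
  have h : b * ‖z‖ - (b - 1) ≤ ‖(b : ℂ) * z - (b - 1 : ℝ)‖ := by
    refine le_trans (le_of_eq ?_) (norm_sub_norm_le _ _)
    rw [norm_mul, Complex.norm_real, Complex.norm_real, Real.norm_of_nonneg (by linarith),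
      Real.norm_of_nonneg (by linarith)]
  rw [cubic_eq_mul, norm_mul, norm_pow]
  have h1 : 1 ≤ ‖(b : ℂ) * z - (b - 1 : ℝ)‖ := by nlinarith
  nlinarith [norm_nonneg z]

theorem norm_cubic_le (hb : 1 ≤ b) (z : ℂ) :
    ‖cubic b z‖ ≤ ‖z‖ ^ 2 * (b * ‖z‖ + (b - 1)) := by
  rw [cubic_eq_mul, norm_mul, norm_pow]
  gcongr
  refine (norm_sub_le _ _).trans (le_of_eq ?_)
  rw [norm_mul, Complex.norm_real, Complex.norm_real, Real.norm_of_nonneg (by linarith),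
    Real.norm_of_nonneg (by linarith)]

theorem isPreconnected_compl_filledJulia_cubic (hb : 1 ≤ b) :
    IsPreconnected (filledJulia (cubic b))ᶜ := by
  refine isPreconnected_compl_filledJulia isOpenMap_cubic
    isClosedMap_cubic two_pos (two_mul_norm_le_norm_cubic hb) (w := ((12 * b : ℝ) : ℂ)) ?_ ?_
  · rw [Complex.norm_real, Real.norm_of_nonneg (by linarith)]
    linarith
  · intro z hz
    by_contra! h
    have h1 := norm_cubic_le hb z
    rw [hz, Complex.norm_real, Real.norm_of_nonneg (by linarith)] at h1
    have h2 : ‖z‖ ^ 2 * (b * ‖z‖ + (b - 1)) ≤ 2 ^ 2 * (b * 2 + (b - 1)) := by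
      gcongr
    linarith

theorem isPreconnected_filledJulia_cubic (hb : 1 ≤ b) (hb' : b ≤ 4) :
    IsPreconnected (filledJulia (cubic b)) := by
  have hb0 : 0 < b := by linarith
  have hbi : 1 / b ≤ 1 := by rw [div_le_one hb0]; exact hb
  have hbi0 : 0 < 1 / b := by positivity
  refine isPreconnected_filledJulia continuous_cubic isOpenMap_cubic
    isClosedMap_cubic two_pos.le (two_mul_norm_le_norm_cubic hb)
    (I := Complex.ofReal '' Icc (-(1 / b)) 1) (w := 0) ?_ ?_ ?_ ?_ ?_
  · exact isPreconnected_Icc.image _ Complex.continuous_ofReal.continuousOn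
  · rintro _ ⟨x, hx, rfl⟩
    rw [mem_closedBall_zero_iff, Complex.norm_real, Real.norm_eq_abs, abs_le]
    constructor <;> linarith [hx.1, hx.2]
  · rintro _ ⟨x, hx, rfl⟩
    refine ⟨_, ⟨?_, ?_⟩, (cubic_ofReal x).symm⟩
    · have : 0 ≤ b * x + 1 := by
        rw [← neg_le_iff_add_nonneg, mul_comm, ← div_le_iff₀ hb0, neg_div]
        exact hx.1
      rw [neg_le_iff_add_nonneg]
      have e : b * x ^ 3 - (b - 1) * x ^ 2 + 1 / b = (b * x + 1) * (b * x ^ 2 - b * x + 1) / b := by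
        field_simp
        ring
      rw [e]
      have : 0 ≤ b * x ^ 2 - b * x + 1 := by nlinarith [sq_nonneg (2 * x - 1), sq_nonneg x]
      positivity
    · have e : 1 - (b * x ^ 3 - (b - 1) * x ^ 2) = (1 - x) * (b * x ^ 2 + x + 1) := by ring
      have h3 : 0 ≤ b * x ^ 2 + x + 1 := by nlinarith [sq_nonneg (x + 1), sq_nonneg x]
      nlinarith [mul_nonneg (sub_nonneg.2 hx.2) h3]
  · exact ⟨0, ⟨by linarith, zero_le_one⟩, Complex.ofReal_zero⟩
  · intro z hz
    rw [mem_preimage, mem_singleton_iff, cubic_eq_mul, mul_eq_zero, sub_eq_zero] at hz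
    rcases hz with hz | hz
    · exact ⟨0, ⟨by linarith, zero_le_one⟩, by simp [pow_eq_zero_iff two_ne_zero |>.1 hz]⟩
    · refine ⟨(b - 1) / b, ⟨?_, ?_⟩, ?_⟩
      · have : 0 ≤ (b - 1) / b := div_nonneg (by linarith) hb0.le
        linarith
      · rw [div_le_one hb0]
        linarith
      · have : (b : ℂ) ≠ 0 := by exact_mod_cast hb0.ne'
        rw [Complex.ofReal_div, ← hz]
        field_simp

theorem isCompact_filledJulia_cubic (hb : 1 ≤ b) : IsCompact (filledJulia (cubic b)) :=
  isCompact_filledJulia continuous_cubic two_pos.le (two_mul_norm_le_norm_cubic hb)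

theorem ofReal_notMem_filledJulia_cubic_of_one_lt (hb : 1 ≤ b) {r : ℝ} (hr : 1 < r) :
    (r : ℂ) ∉ filledJulia (cubic b) := by
  have key : ∀ n : ℕ, ∃ x : ℝ, (cubic b)^[n] r = x ∧ 1 + 2 ^ n * (r - 1) ≤ x := by
    intro n
    induction n with
    | zero => exact ⟨r, rfl, by simp⟩
    | succ n ih =>
      obtain ⟨x, hx, hxn⟩ := ih
      refine ⟨_, by rw [Function.iterate_succ_apply', hx, cubic_ofReal], ?_⟩
      have h0 : 0 < 2 ^ n * (r - 1) := by have := sub_pos.2 hr; positivity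
      have hx1 : 0 ≤ x - 1 := by linarith
      have h3 : 0 ≤ b * x := mul_nonneg (by linarith) (by linarith)
      have h1 : 1 ≤ x * (b * x + 1) := by nlinarith
      have h2 := mul_le_mul_of_nonneg_left h1 hx1
      rw [pow_succ' 2 n]
      linarith
  refine notMem_filledJulia_of_pow_le (sub_pos.2 hr) fun n => ?_
  obtain ⟨x, hx, hxn⟩ := key n
  rw [hx, Complex.norm_real]
  exact le_trans (by linarith) (le_abs_self x)

theorem ofReal_notMem_filledJulia_cubic_of_lt (hb : 1 ≤ b) {r : ℝ} (hr : r < -(1 / b)) :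
    (r : ℂ) ∉ filledJulia (cubic b) := by
  have hb0 : 0 < b := by linarith
  have hbi0 : 0 < 1 / b := by positivity
  have key : ∀ n : ℕ, ∃ x : ℝ, (cubic b)^[n] r = x ∧ x ≤ -(1 / b) - 2 ^ n * (-(1 / b) - r) := by
    intro n
    induction n with
    | zero => exact ⟨r, rfl, by simp⟩
    | succ n ih =>
      obtain ⟨x, hx, hxn⟩ := ih
      refine ⟨_, by rw [Function.iterate_succ_apply', hx, cubic_ofReal], ?_⟩
      have h0 : 0 < 2 ^ n * (-(1 / b) - r) := by have := sub_pos.2 hr; positivity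
      have hx1 : 0 ≤ -(1 / b) - x := by linarith
      have hbb : b * (1 / b) = 1 := by field_simp
      have h3 : b * x ≤ -1 := by nlinarith
      have h1 : 1 ≤ b * x * (x - 1) := by nlinarith
      have h2 := mul_le_mul_of_nonneg_left h1 hx1
      have e : (-(1 / b) - x) * (b * x * (x - 1)) = x - (b * x ^ 3 - (b - 1) * x ^ 2) := by
        field_simp
        ring
      rw [pow_succ' 2 n]
      linarith
  refine notMem_filledJulia_of_pow_le (sub_pos.2 hr) fun n => ?_
  obtain ⟨x, hx, hxn⟩ := key n
  rw [hx, Complex.norm_real]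
  exact le_trans (by linarith) (neg_le_abs x)

theorem one_mem_frontier_filledJulia_cubic (hb : 1 ≤ b) :
    1 ∈ frontier (filledJulia (cubic b)) := by
  rw [frontier_eq_closure_inter_closure]
  refine ⟨subset_closure (mem_filledJulia.2 ⟨1, fun n => ?_⟩), Metric.mem_closure_iff.2
    fun ε hε => ⟨((1 + ε / 2 : ℝ) : ℂ), ofReal_notMem_filledJulia_cubic_of_one_lt hb
      (by linarith), ?_⟩⟩
  · rw [Function.iterate_fixed (by simp [cubic]) n]
    simp
  · rw [← Complex.ofReal_one, Complex.dist_of_im_eq (by simp), Real.dist_eq]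
    simp [abs_of_pos (half_pos hε), hε]

theorem neg_inv_mem_frontier_filledJulia_cubic (hb : 1 ≤ b) :
    ((-(1 / b) : ℝ) : ℂ) ∈ frontier (filledJulia (cubic b)) := by
  have hb0 : b ≠ 0 := by linarith
  rw [frontier_eq_closure_inter_closure]
  refine ⟨subset_closure (mem_filledJulia.2 ⟨‖((-(1 / b) : ℝ) : ℂ)‖, fun n => ?_⟩),
    Metric.mem_closure_iff.2 fun ε hε => ⟨((-(1 / b) - ε / 2 : ℝ) : ℂ),
      ofReal_notMem_filledJulia_cubic_of_lt hb (by linarith), ?_⟩⟩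
  · rw [Function.iterate_fixed ?_ n]
    rw [cubic_ofReal]
    congr 1
    field_simp
    ring
  · rw [Complex.dist_of_im_eq (by simp), Real.dist_eq]
    simp [abs_of_pos (half_pos hε), hε]

theorem isConnected_frontier_filledJulia_cubic (hb : 1 ≤ b) (hb' : b ≤ 4) :
    IsConnected (frontier (filledJulia (cubic b))) :=
  ⟨⟨1, one_mem_frontier_filledJulia_cubic hb⟩, isPreconnected_frontier_of_compl
    (isPreconnected_filledJulia_cubic hb hb') (isPreconnected_compl_filledJulia_cubic hb)⟩

theorem zero_mem_interior_filledJulia_cubic (hb : 1 ≤ b) :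
    0 ∈ interior (filledJulia (cubic b)) := by
  have hb0 : 0 < b := by linarith
  rw [mem_interior_iff_mem_nhds]
  refine Filter.mem_of_superset (closedBall_mem_nhds 0 (show 0 < 1 / (2 * b) by positivity)) ?_
  have hmaps : MapsTo (cubic b) (closedBall 0 (1 / (2 * b))) (closedBall 0 (1 / (2 * b))) := by
    intro z hz
    rw [mem_closedBall_zero_iff] at hz ⊢
    have hz' : ‖z‖ * (2 * b) ≤ 1 := by rwa [le_div_iff₀ (by positivity)] at hz
    have h1 : ‖z‖ * (b * ‖z‖ + (b - 1)) ≤ 1 := by nlinarith [norm_nonneg z]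
    have h2 := norm_cubic_le hb z
    nlinarith [norm_nonneg z, mul_le_mul_of_nonneg_left h1 (norm_nonneg z)]
  exact fun z hz => mem_filledJulia.2 ⟨1 / (2 * b), fun n =>
    mem_closedBall_zero_iff.1 (hmaps.iterate n hz)⟩

/-- On the branch of the hyperbola `3x² - y² = 3sx` through the critical point `s`, the cubic takes
the same value as at a real point. -/
theorem cubic_eq_cubic_ofReal {s : ℝ} (hs : 3 * b * s = 2 * (b - 1)) {z : ℂ}
    (hz : z.im ^ 2 = 3 * z.re ^ 2 - 3 * s * z.re) :
    cubic b z = cubic b ((3 / 2 * s - 2 * z.re : ℝ) : ℂ) := by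
  obtain ⟨x, y⟩ := z
  simp only at hz ⊢
  have hb1 : b - 1 = 3 * b * s / 2 := by linarith
  rw [cubic_ofReal, cubic_eq_mul, hb1]
  apply Complex.ext
  · rw [Complex.ofReal_re]
    simp [pow_two]
    linear_combination (-3 * b * x + 3 / 2 * b * s) * hz
  · rw [Complex.ofReal_im]
    simp [pow_two]
    linear_combination (-b * y) * hz

theorem not_isPreconnected_frontier_filledJulia_cubic (hb : 4 < b) :
    ¬ IsPreconnected (frontier (filledJulia (cubic b))) := by
  intro hJ
  have hb0 : 0 < b := by linarith
  set s : ℝ := 2 * (b - 1) / (3 * b) with hs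
  have hsb : 3 * b * s = 2 * (b - 1) := by rw [hs]; field_simp
  have hs0 : 0 < s := by rw [hs]; exact div_pos (by linarith) (by linarith)
  have hs1 : s < 1 := by rw [hs, div_lt_one (by linarith)]; linarith
  have hs2 : 1 / b < s / 2 := by rw [div_lt_iff₀ hb0]; linarith
  let φ : ℂ → ℝ := fun z => 2 * z.re - s - √(s ^ 2 + 4 / 3 * z.im ^ 2)
  have hφ : Continuous φ := by fun_prop
  have h0 : (0 : ℝ) ∈ Icc (φ ((-(1 / b) : ℝ) : ℂ)) (φ 1) := by
    have hbi0 : 0 < 1 / b := by positivity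
    constructor
    · simp only [φ, Complex.ofReal_re, Complex.ofReal_im]
      have := Real.sqrt_nonneg (s ^ 2 + 4 / 3 * 0 ^ 2)
      linarith
    · simp only [φ, Complex.one_re, Complex.one_im]
      rw [zero_pow two_ne_zero, mul_zero, add_zero, Real.sqrt_sq hs0.le]
      linarith
  obtain ⟨z, hzJ, hz⟩ := hJ.intermediate_value
    (neg_inv_mem_frontier_filledJulia_cubic (by linarith))
    (one_mem_frontier_filledJulia_cubic (by linarith)) hφ.continuousOn h0
  have hzK : z ∈ filledJulia (cubic b) :=
    (isCompact_filledJulia_cubic (by linarith)).isClosed.frontier_subset hzJ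
  have hz' : 2 * z.re - s = √(s ^ 2 + 4 / 3 * z.im ^ 2) := sub_eq_zero.1 hz
  have hsq : (2 * z.re - s) ^ 2 = s ^ 2 + 4 / 3 * z.im ^ 2 := by
    rw [hz', Real.sq_sqrt (by positivity)]
  have hre : s ≤ z.re := by
    have : s ≤ √(s ^ 2 + 4 / 3 * z.im ^ 2) := Real.le_sqrt_of_sq_le (by nlinarith [sq_nonneg z.im])
    linarith
  rw [← apply_mem_filledJulia_iff, cubic_eq_cubic_ofReal hsb (by linarith),
    apply_mem_filledJulia_iff] at hzK
  exact ofReal_notMem_filledJulia_cubic_of_lt (by linarith) (by linarith) hzK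

end Cubic

theorem filledJulia_eq_image_of_conj {f g : ℂ → ℂ} {c : ℂ} (hc : c ≠ 0) (e : ℂ ≃ₜ ℂ)
    (he : ∀ z, e z = c * (z - 1)) (hfg : ∀ z, g (e z) = e (f z)) :
    filledJulia g = e '' filledJulia f := by
  have hiter : ∀ n z, g^[n] (e z) = e (f^[n] z) := fun n z =>
    ((show Function.Semiconj e f g from fun z => (hfg z).symm).iterate_right n z).symm
  have hc' : 0 < ‖c‖ := norm_pos_iff.2 hc
  ext w
  obtain ⟨z, rfl⟩ := e.surjective w
  rw [e.injective.mem_set_image, mem_filledJulia, mem_filledJulia]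
  simp only [hiter]
  have he' : ∀ z, ‖e z‖ = ‖c‖ * ‖z - 1‖ := fun z => by rw [he, norm_mul]
  simp only [he']
  constructor
  · rintro ⟨C, hC⟩
    refine ⟨C / ‖c‖ + 1, fun n => ?_⟩
    have h1 : ‖f^[n] z - 1‖ ≤ C / ‖c‖ := by
      rw [le_div_iff₀' hc']
      exact hC n
    have h2 := norm_sub_norm_le (f^[n] z) 1
    rw [norm_one] at h2
    linarith
  · rintro ⟨C, hC⟩
    refine ⟨‖c‖ * (C + 1), fun n => ?_⟩
    gcongr
    have h2 := norm_sub_le (f^[n] z) 1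
    rw [norm_one] at h2
    linarith [hC n]

/-- For a finite simple graph with independence number 3 whose reduced
independence polynomial is `P(z) = a₁z + a₂z² + a₃z³`, if `a₁ ≥ 4` and
`a₂²·(a₁−2) = a₃·(2a₁−3)²`, then the Julia set of `P` is connected when `a₁ ≤ 6`, and is
not connected but not totally disconnected when `a₁ > 6`. -/
theorem stmt_7 {V : Type*} [Fintype V] [DecidableEq V]
    (G : SimpleGraph V) [DecidableRel G.Adj]
    (a₁ a₂ a₃ : ℕ)
    (ha₁ : a₁ = Fintype.card V)
    (ha₂ : a₂ = (Finset.univ.filter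
      (fun s : Finset V => s.card = 2 ∧ ∀ u ∈ s, ∀ v ∈ s, ¬ G.Adj u v)).card)
    (ha₃ : a₃ = (Finset.univ.filter
      (fun s : Finset V => s.card = 3 ∧ ∀ u ∈ s, ∀ v ∈ s, ¬ G.Adj u v)).card)
    (hindep3 : ∃ s : Finset V, s.card = 3 ∧ ∀ u ∈ s, ∀ v ∈ s, ¬ G.Adj u v)
    (hindep4 : ¬ ∃ s : Finset V, s.card = 4 ∧ ∀ u ∈ s, ∀ v ∈ s, ¬ G.Adj u v)
    (P : ℂ → ℂ)
    (hP : ∀ z, P z = a₁ * z + a₂ * z ^ 2 + a₃ * z ^ 3)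
    (ha : 4 ≤ a₁)
    (heq : (a₂ : ℤ) ^ 2 * ((a₁ : ℤ) - 2) = a₃ * (2 * (a₁ : ℤ) - 3) ^ 2) :
    (a₁ ≤ 6 →
      IsConnected
        (frontier {z : ℂ | Bornology.IsBounded (Set.range fun n => P^[n] z)})) ∧
    (6 < a₁ →
      ¬ IsConnected
          (frontier {z : ℂ | Bornology.IsBounded (Set.range fun n => P^[n] z)}) ∧
        ∃ t ⊆ frontier {z : ℂ | Bornology.IsBounded (Set.range fun n => P^[n] z)},
          IsPreconnected t ∧ ∃ x ∈ t, ∃ y ∈ t, x ≠ y) := by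
  have h3 : 0 < a₃ := by
    obtain ⟨s, hs⟩ := hindep3
    rw [ha₃]
    exact Finset.card_pos.2 ⟨s, by simpa using hs⟩
  obtain ⟨b, hb⟩ : ∃ b : ℝ, b = a₁ - 2 := ⟨_, rfl⟩
  have ha' : (4 : ℝ) ≤ a₁ := by exact_mod_cast ha
  have heqR : (a₂ : ℝ) ^ 2 * b = a₃ * (2 * b + 1) ^ 2 := by
    have : (a₂ : ℝ) ^ 2 * ((a₁ : ℝ) - 2) = a₃ * (2 * (a₁ : ℝ) - 3) ^ 2 := by exact_mod_cast heq
    rw [hb, this]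
    ring
  have hb1 : 1 ≤ b := by linarith
  have h2 : (a₂ : ℂ) ≠ 0 := by
    intro h
    have h2 : (a₂ : ℝ) = 0 := by exact_mod_cast h
    have h3' : (0 : ℝ) < a₃ := by exact_mod_cast h3
    have : 0 < (a₃ : ℝ) * (2 * b + 1) ^ 2 := by positivity
    rw [← heqR, h2] at this
    simp at this
  have hb2 : (2 * b + 1 : ℂ) ≠ 0 := by
    have : (2 * b + 1 : ℝ) ≠ 0 := by linarith
    exact_mod_cast this
  have heqC : (a₂ : ℂ) ^ 2 * b = a₃ * (2 * b + 1) ^ 2 := by exact_mod_cast heqR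
  have hbC : (a₁ : ℂ) = b + 2 := by
    rw [hb]
    push_cast
    ring
  set c : ℂ := (2 * b + 1) / a₂ with hc
  have hc0 : c ≠ 0 := div_ne_zero hb2 h2
  have hca : c * a₂ = 2 * b + 1 := div_mul_cancel₀ _ h2
  have hca3 : c ^ 2 * a₃ = b := by
    rw [hc]
    field_simp
    linear_combination -heqC
  let e : ℂ ≃ₜ ℂ := (Homeomorph.subRight (1 : ℂ)).trans (Homeomorph.mulLeft₀ c hc0)
  have he : ∀ z, e z = c * (z - 1) := fun z => rfl
  have hK : {z : ℂ | Bornology.IsBounded (Set.range fun n => P^[n] z)} =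
      e '' filledJulia (cubic b) := by
    refine filledJulia_eq_image_of_conj hc0 e he fun z => ?_
    rw [hP, he, he, cubic, hbC]
    linear_combination c * (z - 1) ^ 2 * hca + c * (z - 1) ^ 3 * hca3
  rw [hK, ← e.image_frontier]
  constructor
  · intro h
    have h' : (a₁ : ℝ) ≤ 6 := by exact_mod_cast h
    exact (isConnected_frontier_filledJulia_cubic hb1 (by linarith)).image e
      e.continuous.continuousOn
  · intro h
    have h' : (6 : ℝ) < a₁ := by exact_mod_cast h
    refine ⟨fun hJ => not_isPreconnected_frontier_filledJulia_cubic (b := b) (by linarith)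
      (e.isPreconnected_image.1 hJ.isPreconnected), ?_⟩
    obtain ⟨t, ht, htc, x, hx, y, hy, hxy⟩ := exists_nontrivial_isPreconnected_subset_frontier
      (isCompact_filledJulia_cubic hb1) ⟨0, zero_mem_interior_filledJulia_cubic hb1⟩
    exact ⟨e '' t, image_mono ht, htc.image e e.continuous.continuousOn, e x,
      mem_image_of_mem e hx, e y, mem_image_of_mem e hy, e.injective.ne hxy⟩
end

section
/- Let G be a finite simple graph with independence number 3, let a₁ be the number of vertices of G, a₂ the number of 2-element independent sets, and a₃ the number of 3-element independent sets, and let P(z) = a₁z + a₂z² + a₃z³ as a map ℂ → ℂ. Suppose a₁ ≥ 4, 4·a₃·(a₁ − 2)² < a₂²·(a₁ − 3), and a₂² < 4·a₁·a₃. If (a₁, a₂, a₃) is neither (7, 9, 3) nor (8, 11, 4), then the Julia set J(P) is not connected. -/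
/-- If a self-map of `ℂ` restricts to the reals and moves every real `t ≤ t₀` to the left by at
least `δ > 0`, then the orbit of every such point is unbounded. -/
lemma not_isBounded_orbit_of_decrease {P : ℂ → ℂ} {f : ℝ → ℝ} (hf : ∀ t : ℝ, P t = f t)
    {t₀ δ : ℝ} (hδ : 0 < δ) (h : ∀ t ≤ t₀, f t ≤ t - δ) :
    ¬ Bornology.IsBounded (Set.range fun n => P^[n] (t₀ : ℂ)) := by
  have key : ∀ n : ℕ, ∃ t : ℝ, P^[n] (t₀ : ℂ) = t ∧ t ≤ t₀ - n * δ := by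
    intro n
    induction n with
    | zero => exact ⟨t₀, by simp, by simp⟩
    | succ n ih =>
      obtain ⟨t, ht, hle⟩ := ih
      refine ⟨f t, by rw [Function.iterate_succ_apply', ht, hf], ?_⟩
      have hn : 0 ≤ (n : ℝ) * δ := by positivity
      have := h t (by linarith)
      push_cast
      linarith
  intro hb
  obtain ⟨C, hC⟩ := isBounded_iff_forall_norm_le.mp hb
  obtain ⟨n, hn⟩ := exists_nat_gt ((C + t₀) / δ)
  obtain ⟨t, ht, hle⟩ := key n
  have h1 := hC _ ⟨n, rfl⟩
  simp only [ht, Complex.norm_real, Real.norm_eq_abs] at h1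
  rw [div_lt_iff₀ hδ] at hn
  linarith [neg_abs_le t]

/-- If a self-map of `ℂ` restricts to the reals and moves every real `t ≥ t₀` to the right by at
least `δ > 0`, then the orbit of every such point is unbounded. -/
lemma not_isBounded_orbit_of_increase {P : ℂ → ℂ} {f : ℝ → ℝ} (hf : ∀ t : ℝ, P t = f t)
    {t₀ δ : ℝ} (hδ : 0 < δ) (h : ∀ t, t₀ ≤ t → t + δ ≤ f t) :
    ¬ Bornology.IsBounded (Set.range fun n => P^[n] (t₀ : ℂ)) := by
  have key : ∀ n : ℕ, ∃ t : ℝ, P^[n] (t₀ : ℂ) = t ∧ t₀ + n * δ ≤ t := by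
    intro n
    induction n with
    | zero => exact ⟨t₀, by simp, by simp⟩
    | succ n ih =>
      obtain ⟨t, ht, hle⟩ := ih
      refine ⟨f t, by rw [Function.iterate_succ_apply', ht, hf], ?_⟩
      have hn : 0 ≤ (n : ℝ) * δ := by positivity
      have := h t (by linarith)
      push_cast
      linarith
  intro hb
  obtain ⟨C, hC⟩ := isBounded_iff_forall_norm_le.mp hb
  obtain ⟨n, hn⟩ := exists_nat_gt ((C - t₀) / δ)
  obtain ⟨t, ht, hle⟩ := key n
  have h1 := hC _ ⟨n, rfl⟩
  simp only [ht, Complex.norm_real, Real.norm_eq_abs] at h1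
  rw [div_lt_iff₀ hδ] at hn
  linarith [le_abs_self t]

lemma isBounded_orbit_of_map_isBounded_orbit {P : ℂ → ℂ} {z : ℂ}
    (h : Bornology.IsBounded (Set.range fun n => P^[n] z)) :
    Bornology.IsBounded (Set.range fun n => P^[n] (P z)) := by
  refine h.subset ?_
  rintro _ ⟨n, rfl⟩
  exact ⟨n + 1, by simp⟩

lemma isBounded_orbit_of_fixed {P : ℂ → ℂ} {z : ℂ} (h : P z = z) :
    Bornology.IsBounded (Set.range fun n => P^[n] z) := by
  have : (fun n => P^[n] z) = fun _ : ℕ => z := funext fun n => Function.iterate_fixed h n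
  rw [this]
  exact (Set.finite_range_const (c := z)).isBounded

/-- The filled-in Julia set of a continuous map that expands the complement of a disc by a
definite amount is closed. -/
lemma isClosed_setOf_isBounded_orbit {P : ℂ → ℂ} (hP : Continuous P) {R : ℝ}
    (h : ∀ z, R < ‖z‖ → ‖z‖ + 1 ≤ ‖P z‖) :
    IsClosed {z : ℂ | Bornology.IsBounded (Set.range fun n => P^[n] z)} := by
  have heq : {z : ℂ | Bornology.IsBounded (Set.range fun n => P^[n] z)} =
      {z : ℂ | ∀ n : ℕ, ‖P^[n] z‖ ≤ R} := by
    ext z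
    simp only [Set.mem_ofPred_eq]
    constructor
    · intro hb n
      by_contra! hn
      have key : ∀ k : ℕ, ‖P^[n] z‖ + k ≤ ‖P^[n + k] z‖ := by
        intro k
        induction k with
        | zero => simp
        | succ k ih =>
          have hk : (0 : ℝ) ≤ k := Nat.cast_nonneg k
          have := h (P^[n + k] z) (by linarith)
          rw [← add_assoc, Function.iterate_succ_apply']
          push_cast
          linarith
      obtain ⟨C, hC⟩ := isBounded_iff_forall_norm_le.mp hb
      obtain ⟨k, hk⟩ := exists_nat_gt C
      have h1 := hC _ ⟨n + k, rfl⟩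
      have h2 := key k
      simp only at h1
      linarith [norm_nonneg (P^[n] z)]
    · intro hb
      refine isBounded_iff_forall_norm_le.mpr ⟨R, ?_⟩
      rintro _ ⟨n, rfl⟩
      exact hb n
  rw [heq, Set.ofPred_forall]
  exact isClosed_iInter fun n => isClosed_le (hP.iterate n).norm continuous_const

lemma norm_add_one_le_norm_cubic {a b c : ℝ} (ha : 0 ≤ a) (hb : 0 ≤ b) (hc : 1 ≤ c) {z : ℂ}
    (hz : a + b + 2 < ‖z‖) :
    ‖z‖ + 1 ≤ ‖(a : ℂ) * z + b * z ^ 2 + c * z ^ 3‖ := by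
  have h1 : ‖(c : ℂ) * z ^ 3‖ ≤
      ‖(a : ℂ) * z + b * z ^ 2 + c * z ^ 3‖ + (‖(a : ℂ) * z‖ + ‖(b : ℂ) * z ^ 2‖) := by
    calc ‖(c : ℂ) * z ^ 3‖
        = ‖((a : ℂ) * z + b * z ^ 2 + c * z ^ 3) - (a * z + b * z ^ 2)‖ := by congr 1; ring
      _ ≤ _ := (norm_sub_le _ _).trans (by gcongr; exact norm_add_le _ _)
  simp only [norm_mul, norm_pow, Complex.norm_real, Real.norm_eq_abs, abs_of_nonneg ha,
    abs_of_nonneg hb, abs_of_nonneg (zero_le_one.trans hc)] at h1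
  set r := ‖z‖
  have hr : 0 < r := by linarith
  have h2 : r ^ 3 ≤ c * r ^ 3 := le_mul_of_one_le_left (by positivity) hc
  have h3 : 2 ≤ r ^ 2 - b * r - a := by nlinarith
  nlinarith

/-- A real cubic `az + bz² + cz³` with a critical point whose value lies beyond the outermost real
fixed point has disconnected Julia set. -/
lemma not_isConnected_julia_cubic {a b c u p p' : ℝ} (ha : 1 < a) (hb : 0 ≤ b) (hc : 1 ≤ c)
    (hcrit : 3 * c * u ^ 2 + 2 * b * u + a = 0) (hu : 0 < 3 * c * u + b)
    (hpp : p ≤ p')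
    (hfix : ∀ t, a * t + b * t ^ 2 + c * t ^ 3 - t = c * t * (t - p) * (t - p'))
    (hpu : p < u) (hval : a * u + b * u ^ 2 + c * u ^ 3 < p)
    (P : ℂ → ℂ) (hP : ∀ z, P z = a * z + b * z ^ 2 + c * z ^ 3) :
    ¬ IsConnected
        (frontier {z : ℂ | Bornology.IsBounded (Set.range fun n => P^[n] z)}) := by
  have hc0 : 0 < c := by linarith
  have hu0 : u < 0 := by nlinarith [sq_nonneg u]
  have hreal : ∀ t : ℝ, P t = ((a * t + b * t ^ 2 + c * t ^ 3 : ℝ) : ℂ) := by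
    intro t; rw [hP]; push_cast; ring
  have hleft : ∀ t : ℝ, t < p →
      ¬ Bornology.IsBounded (Set.range fun n => P^[n] (t : ℂ)) := by
    intro t ht
    refine not_isBounded_orbit_of_decrease hreal (δ := c * (-p) * (p - t) ^ 2)
      (by have : 0 < -p := by linarith
          have : 0 < p - t := by linarith
          positivity) ?_
    intro s hs
    have h1 : (p - t) ^ 2 ≤ (p - s) * (p' - s) := by
      rw [sq]; apply mul_le_mul <;> linarith
    have h2 : c * (-p) * (p - t) ^ 2 ≤ c * (-s) * ((p - s) * (p' - s)) := by
      apply mul_le_mul _ h1 (by positivity)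
      · have : 0 < -s := by linarith
        positivity
      · apply mul_le_mul_of_nonneg_left _ hc0.le; linarith
    linarith [hfix s]
  have hright : ∀ t : ℝ, 0 < t →
      ¬ Bornology.IsBounded (Set.range fun n => P^[n] (t : ℂ)) := by
    intro t ht
    refine not_isBounded_orbit_of_increase hreal (δ := (a - 1) * t)
      (mul_pos (by linarith) ht) ?_
    intro s hs
    have h0 : 0 < s := by linarith
    have : 0 ≤ b * s ^ 2 + c * s ^ 3 := by positivity
    nlinarith
  set K := {z : ℂ | Bornology.IsBounded (Set.range fun n => P^[n] z)}
  have hcont : Continuous P := by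
    rw [show P = fun z : ℂ => (a : ℂ) * z + b * z ^ 2 + c * z ^ 3 from funext fun z => hP z]
    fun_prop
  have hclosed : IsClosed K := isClosed_setOf_isBounded_orbit hcont (R := a + b + 2) fun z hz => by
    rw [hP]; exact norm_add_one_le_norm_cubic (by linarith) hb hc hz
  have hcurve : ∀ z : ℂ, u ≤ z.re → c * z.im ^ 2 = 3 * c * z.re ^ 2 + 2 * b * z.re + a →
      z ∉ K := by
    intro z hre him hz
    obtain ⟨x, y⟩ := z
    simp only at hre him
    have hPz : P ⟨x, y⟩ = ((a * x + b * (x ^ 2 - y ^ 2) + c * (x ^ 3 - 3 * x * y ^ 2) : ℝ) : ℂ) := by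
      rw [hP]
      apply Complex.ext
      · simp [pow_succ]; left; ring
      · simp [pow_succ]; linear_combination -y * him
    refine hleft _ ?_ (hPz ▸ isBounded_orbit_of_map_isBounded_orbit hz)
    refine lt_of_le_of_lt ?_ hval
    refine le_of_mul_le_mul_left ?_ hc0
    have hd : 0 ≤ x - u := by linarith
    have h1 : 0 ≤ 8 * c ^ 2 * (x - u) ^ 3 + 8 * c * (3 * c * u + b) * (x - u) ^ 2
        + 2 * (3 * c * u + b) ^ 2 * (x - u) := by positivity
    have hkey : c * (a * x + b * (x ^ 2 - y ^ 2) + c * (x ^ 3 - 3 * x * y ^ 2))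
        - c * (a * u + b * u ^ 2 + c * u ^ 3) =
        -(8 * c ^ 2 * (x - u) ^ 3 + 8 * c * (3 * c * u + b) * (x - u) ^ 2
        + 2 * (3 * c * u + b) ^ 2 * (x - u)) := by
      obtain rfl : a = -(3 * c * u ^ 2 + 2 * b * u) := by linarith
      linear_combination (-(b + 3 * c * x)) * him
    linarith
  have h0 : (0 : ℂ) ∈ frontier K := by
    refine ⟨subset_closure (isBounded_orbit_of_fixed (by simp [hP])), fun hint => ?_⟩
    obtain ⟨ε, hε, hball⟩ := Metric.mem_nhds_iff.mp (mem_interior_iff_mem_nhds.mp hint)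
    refine hright (ε / 2) (by linarith) (hball ?_)
    rw [mem_ball_zero_iff, Complex.norm_real, Real.norm_eq_abs, abs_of_pos (by linarith)]
    linarith
  have hp : (p : ℂ) ∈ frontier K := by
    refine ⟨subset_closure (isBounded_orbit_of_fixed ?_), fun hint => ?_⟩
    · rw [hreal]; congr 1; linear_combination hfix p
    obtain ⟨ε, hε, hball⟩ := Metric.mem_nhds_iff.mp (mem_interior_iff_mem_nhds.mp hint)
    refine hleft (p - ε / 2) (by linarith) (hball ?_)
    rw [Metric.mem_ball, dist_eq_norm, ← Complex.ofReal_sub, Complex.norm_real, Real.norm_eq_abs,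
      abs_lt]
    constructor <;> linarith
  rintro ⟨-, hpre⟩
  obtain ⟨z, -, ⟨hz1, hz2⟩, hz3⟩ := hpre
    ({z : ℂ | u < z.re} ∩ {z : ℂ | c * z.im ^ 2 < 3 * c * z.re ^ 2 + 2 * b * z.re + a})
    ({z : ℂ | z.re < u} ∪ {z : ℂ | 3 * c * z.re ^ 2 + 2 * b * z.re + a < c * z.im ^ 2})
    (by apply (isOpen_lt _ _).inter (isOpen_lt _ _) <;> fun_prop)
    (by apply (isOpen_lt _ _).union (isOpen_lt _ _) <;> fun_prop)
    (by
      intro z hz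
      have hzK : z ∈ K := hclosed.frontier_subset hz
      have hn := hcurve z
      simp only [Set.mem_union, Set.mem_inter_iff, Set.mem_ofPred_eq]
      rcases lt_trichotomy z.re u with h | h | h
      · exact Or.inr (Or.inl h)
      · right; right
        rw [h, hcrit]
        rcases (sq_nonneg z.im).eq_or_lt with hy | hy
        · exact absurd hzK (hn h.ge (by rw [h, hcrit, ← hy, mul_zero]))
        · positivity
      · rcases lt_trichotomy (c * z.im ^ 2) (3 * c * z.re ^ 2 + 2 * b * z.re + a) with h' | h' | h'
        · exact Or.inl ⟨h, h'⟩
        · exact absurd hzK (hn h.le h')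
        · exact Or.inr (Or.inr h'))
    ⟨0, h0, by simpa using hu0, by simp; linarith⟩
    ⟨p, hp, Or.inl (by simpa using hpu)⟩
  simp only [Set.mem_union, Set.mem_ofPred_eq] at hz1 hz2 hz3
  rcases hz3 with h | h <;> linarith

/-- A criterion for the Julia set of `az + bz² + cz³` to be disconnected, in terms of a point `x`
close to the local minimum and a point `q` to the left of all real fixed points. -/
lemma not_isConnected_julia_cubic_of_witness {a b c x q : ℝ} (ha : 4 ≤ a) (hb : 0 < b)
    (hc : 1 ≤ c) (hdisc : 4 * c * (a - 1) < b ^ 2) (hx : -b ≤ 3 * c * x)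
    (hxq : a * x + b * x ^ 2 + c * x ^ 3 ≤ q) (hq : 0 < c * q ^ 2 + b * q + a - 1)
    (hqb : 2 * c * q + b < 0)
    (P : ℂ → ℂ) (hP : ∀ z, P z = a * z + b * z ^ 2 + c * z ^ 3) :
    ¬ IsConnected
        (frontier {z : ℂ | Bornology.IsBounded (Set.range fun n => P^[n] z)}) := by
  have hc0 : 0 < c := by linarith
  have hcd : 0 < b ^ 2 - 3 * a * c := by nlinarith
  have hfd : 0 < b ^ 2 - 4 * c * (a - 1) := by linarith
  obtain ⟨s, hs, hs2⟩ : ∃ s : ℝ, 0 < s ∧ s ^ 2 = b ^ 2 - 3 * a * c :=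
    ⟨_, Real.sqrt_pos.mpr hcd, Real.sq_sqrt hcd.le⟩
  obtain ⟨r, hr, hr2⟩ : ∃ r : ℝ, 0 < r ∧ r ^ 2 = b ^ 2 - 4 * c * (a - 1) :=
    ⟨_, Real.sqrt_pos.mpr hfd, Real.sq_sqrt hfd.le⟩
  obtain ⟨u, hu⟩ : ∃ u : ℝ, 3 * c * u + b = s := ⟨(s - b) / (3 * c), by field_simp; ring⟩
  obtain ⟨p, hp⟩ : ∃ p : ℝ, 2 * c * p + b = -r := ⟨(-r - b) / (2 * c), by field_simp; ring⟩
  obtain ⟨p', hp'⟩ : ∃ p' : ℝ, 2 * c * p' + b = r := ⟨(r - b) / (2 * c), by field_simp; ring⟩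
  have hcrit : 3 * c * u ^ 2 + 2 * b * u + a = 0 := by
    apply mul_left_cancel₀ hc0.ne'
    subst hu
    linear_combination hs2 / 3
  have hsum : c * (p + p') = -b := by linarith
  have hprod : c * (p * p') = a - 1 := by
    apply mul_left_cancel₀ hc0.ne'
    obtain rfl : r = 2 * c * p' + b := hp'.symm
    obtain rfl : b = -(c * (p + p')) := by linarith
    linear_combination -hr2 / 4
  have hqp : q < p := by
    by_contra! h
    have h1 : q < p' := by nlinarith
    have : c * q ^ 2 + b * q + a - 1 = c * ((q - p) * (q - p')) := by
      linear_combination q * hsum - hprod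
    have h2 : (q - p) * (q - p') ≤ 0 := mul_nonpos_of_nonneg_of_nonpos (by linarith) (by linarith)
    nlinarith
  have hxu : a * u + b * u ^ 2 + c * u ^ 3 ≤ a * x + b * x ^ 2 + c * x ^ 3 := by
    have : a * x + b * x ^ 2 + c * x ^ 3 - (a * u + b * u ^ 2 + c * u ^ 3) =
        (x - u) ^ 2 * (c * x + 2 * c * u + b) := by
      linear_combination (x - u) * hcrit
    have h2 : 0 ≤ c * x + 2 * c * u + b := by nlinarith
    nlinarith [mul_nonneg (sq_nonneg (x - u)) h2]
  refine not_isConnected_julia_cubic (u := u) (p := p) (p' := p') (by linarith) hb.le hc hcrit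
    (by rw [hu]; exact hs) ?_ ?_ ?_ (by linarith) P hP
  · nlinarith
  · intro t
    linear_combination t ^ 2 * hsum - t * hprod
  · nlinarith

/-- Double counting of incidences between vertices and the members of a uniform set family. -/
lemma sum_card_filter_mem_eq {V : Type*} [Fintype V] [DecidableEq V] (S : Finset (Finset V))
    {k : ℕ} (hS : ∀ s ∈ S, s.card = k) :
    ∑ v : V, (S.filter fun s => v ∈ s).card = k * S.card := by
  simp only [Finset.card_filter]
  rw [Finset.sum_comm, mul_comm, ← smul_eq_mul, ← Finset.sum_const]
  refine Finset.sum_congr rfl fun s hs => ?_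
  rw [← hS s hs, ← Finset.card_filter, Finset.filter_mem_eq_inter, Finset.univ_inter]

/-- Moon–Moser inequality for the complement of a graph: if a graph on `n` vertices has `e`
independent pairs, then it has at least `e (4 e - n²) / (3 n)` independent triples. -/
lemma moon_moser {V : Type*} [Fintype V] [DecidableEq V] (G : SimpleGraph V) [DecidableRel G.Adj] :
    (Finset.univ.filter
      (fun s : Finset V => s.card = 2 ∧ ∀ u ∈ s, ∀ v ∈ s, ¬ G.Adj u v)).card *
      (4 * (Finset.univ.filter
      (fun s : Finset V => s.card = 2 ∧ ∀ u ∈ s, ∀ v ∈ s, ¬ G.Adj u v)).card) ≤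
    3 * Fintype.card V * (Finset.univ.filter
      (fun s : Finset V => s.card = 3 ∧ ∀ u ∈ s, ∀ v ∈ s, ¬ G.Adj u v)).card +
    (Finset.univ.filter
      (fun s : Finset V => s.card = 2 ∧ ∀ u ∈ s, ∀ v ∈ s, ¬ G.Adj u v)).card *
      Fintype.card V ^ 2 := by
  set S₂ := Finset.univ.filter
      (fun s : Finset V => s.card = 2 ∧ ∀ u ∈ s, ∀ v ∈ s, ¬ G.Adj u v) with hS₂
  set S₃ := Finset.univ.filter
      (fun s : Finset V => s.card = 3 ∧ ∀ u ∈ s, ∀ v ∈ s, ¬ G.Adj u v) with hS₃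
  set N : V → Finset V := fun v => Finset.univ.filter fun w => w ≠ v ∧ ¬ G.Adj v w with hN
  have hdeg : ∀ v, (S₂.filter fun s => v ∈ s).card = (N v).card := by
    intro v
    symm
    refine Finset.card_bij (fun w _ => {v, w}) ?_ ?_ ?_
    · intro w hw
      simp only [hN, Finset.mem_filter, Finset.mem_univ, true_and] at hw
      simp only [hS₂, Finset.mem_filter, Finset.mem_univ, true_and]
      refine ⟨⟨Finset.card_pair hw.1.symm, ?_⟩, by simp⟩
      simp [hw.2, G.adj_comm w v]
    · intro w hw w' hw' h
      simp only [hN, Finset.mem_filter, Finset.mem_univ, true_and] at hw hw'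
      have : w ∈ ({v, w'} : Finset V) := h ▸ (by simp)
      simpa [hw.1] using this
    · intro s hs
      simp only [hS₂, Finset.mem_filter, Finset.mem_univ, true_and] at hs
      obtain ⟨⟨hcard, hind⟩, hv⟩ := hs
      obtain ⟨w, hw⟩ := Finset.card_eq_one.mp (by rw [Finset.card_erase_of_mem hv, hcard] :
        (s.erase v).card = 1)
      have hmem : w ∈ s.erase v := by simp [hw]
      refine ⟨w, ?_, ?_⟩
      · simp only [hN, Finset.mem_filter, Finset.mem_univ, true_and]
        exact ⟨Finset.ne_of_mem_erase hmem, hind v hv w (Finset.mem_of_mem_erase hmem)⟩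
      · rw [← Finset.insert_erase hv, hw]
  have hsum₂ : ∑ v, (N v).card = 2 * S₂.card := by
    rw [← sum_card_filter_mem_eq S₂ (k := 2) (by simp +contextual [hS₂])]
    exact Finset.sum_congr rfl fun v _ => (hdeg v).symm
  have hsum₃ : ∑ v, (S₃.filter fun s => v ∈ s).card = 3 * S₃.card :=
    sum_card_filter_mem_eq S₃ (by simp +contextual [hS₃])
  have hlink : ∀ v, ∑ w ∈ N v, (N v ∩ N w).card ≤ 2 * (S₃.filter fun s => v ∈ s).card := by
    intro v
    have h1 : ∀ w ∈ N v, (N v ∩ N w).card ≤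
        ((S₃.filter fun s => v ∈ s).filter fun s => w ∈ s).card := by
      intro w hw
      refine Finset.card_le_card_of_injOn (fun x => {v, w, x}) ?_ ?_
      · intro x hx
        simp only [hN, Finset.coe_inter, Finset.coe_filter, Finset.mem_filter, Finset.mem_univ,
          true_and, Set.mem_inter_iff, Set.mem_ofPred_eq] at hw hx
        simp only [hS₃, Finset.coe_filter, Finset.mem_filter, Finset.mem_univ, true_and,
          Set.mem_ofPred_eq]
        refine ⟨⟨⟨Finset.card_eq_three.mpr
          ⟨v, w, x, hw.1.symm, hx.1.1.symm, hx.2.1.symm, rfl⟩, ?_⟩, by simp⟩, by simp⟩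
        simp [hw.2, hx.1.2, hx.2.2, G.adj_comm w v, G.adj_comm x v, G.adj_comm x w]
      · intro x hx y hy h
        simp only [hN, Finset.coe_inter, Finset.coe_filter, Finset.mem_univ,
          true_and, Set.mem_inter_iff, Set.mem_ofPred_eq] at hx hy
        have : x ∈ ({v, w, y} : Finset V) := by
          simp only at h
          rw [← h]; simp
        simpa [hx.1.1, hx.2.1] using this
    refine (Finset.sum_le_sum h1).trans ?_
    have h2 : ∀ s ∈ S₃.filter fun s => v ∈ s, ((N v).filter fun w => w ∈ s).card ≤ 2 := by
      intro s hs
      simp only [hS₃, Finset.mem_filter, Finset.mem_univ, true_and] at hs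
      have : (N v).filter (fun w => w ∈ s) ⊆ s.erase v := by
        intro w hw
        simp only [hN, Finset.mem_filter, Finset.mem_univ, true_and] at hw
        exact Finset.mem_erase.mpr ⟨hw.1.1, hw.2⟩
      refine (Finset.card_le_card this).trans ?_
      rw [Finset.card_erase_of_mem hs.2, hs.1.1]
    simp only [Finset.card_filter (fun s => _ ∈ s)]
    rw [Finset.sum_comm]
    simp only [← Finset.card_filter]
    rw [mul_comm, ← smul_eq_mul]
    exact Finset.sum_le_card_nsmul _ _ _ h2
  have hinc : ∀ v w, ((N v).card : ℤ) + (N w).card - Fintype.card V ≤ (N v ∩ N w).card := by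
    intro v w
    have h1 := Finset.card_union_add_card_inter (N v) (N w)
    have h2 := Finset.card_le_univ (N v ∪ N w)
    omega
  have hsymm : ∑ v, ∑ w ∈ N v, ((N w).card : ℤ) = ∑ v, ((N v).card : ℤ) ^ 2 := by
    simp only [hN, Finset.sum_filter]
    rw [Finset.sum_comm]
    refine Finset.sum_congr rfl fun w _ => ?_
    rw [← Finset.sum_filter, Finset.sum_const, nsmul_eq_mul, sq]
    congr 3
    ext v
    simp [G.adj_comm w v, ne_comm]
  have hmain : 2 * ∑ v, ((N v).card : ℤ) ^ 2 - Fintype.card V * (2 * S₂.card) ≤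
      6 * S₃.card := by
    have h1 : ∑ v, ∑ w ∈ N v, (((N v).card : ℤ) + (N w).card - Fintype.card V) ≤
        ∑ v, (2 * (S₃.filter fun s => v ∈ s).card : ℤ) := by
      refine Finset.sum_le_sum fun v _ => ?_
      refine (Finset.sum_le_sum fun w _ => hinc v w).trans ?_
      exact_mod_cast hlink v
    have h2 : ∑ v, ((N v).card : ℤ) = 2 * S₂.card := by exact_mod_cast hsum₂
    have h3 : ∑ v, ((S₃.filter fun s => v ∈ s).card : ℤ) = 3 * S₃.card := by exact_mod_cast hsum₃
    rw [← Finset.mul_sum, h3] at h1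
    simp only [Finset.sum_sub_distrib, Finset.sum_add_distrib, Finset.sum_const, hsymm,
      nsmul_eq_mul, ← Finset.sum_mul, h2, ← sq] at h1
    linarith
  have hcs : (2 * (S₂.card : ℤ)) ^ 2 ≤ Fintype.card V * ∑ v, ((N v).card : ℤ) ^ 2 := by
    have h2 : ∑ v, ((N v).card : ℤ) = 2 * S₂.card := by exact_mod_cast hsum₂
    rw [← h2]
    exact sq_sum_le_card_mul_sum_sq
  zify
  have hn : (0 : ℤ) ≤ Fintype.card V := Int.natCast_nonneg _
  nlinarith [mul_le_mul_of_nonneg_left hmain hn]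

/-- Arithmetic constraints leave few triples with fewer than nine vertices. -/
lemma nine_le_or_exceptional {a b c : ℕ} (ha : 4 ≤ a)
    (hlow : 4 * c * ((a : ℤ) - 2) ^ 2 < (b : ℤ) ^ 2 * ((a : ℤ) - 3))
    (hhigh : b ^ 2 < 4 * a * c) (hmm : b * (4 * b) ≤ 3 * a * c + b * a ^ 2)
    (hexc : ¬ ((a, b, c) = (7, 9, 3) ∨ (a, b, c) = (8, 11, 4))) :
    9 ≤ a ∨ (a = 8 ∧ b = 17 ∧ c = 10) ∨ (a = 8 ∧ b = 18 ∧ c = 11) ∨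
      (a = 8 ∧ b = 19 ∧ c = 12) := by
  simp only [Prod.mk.injEq] at hexc
  rcases lt_or_ge a 9 with h | h
  swap
  · exact Or.inl h
  have hb : b < 21 := by
    zify at hhigh hmm ⊢
    interval_cases a <;> norm_num at * <;> nlinarith
  interval_cases a <;> norm_num at hlow hhigh hmm hexc ⊢ <;> interval_cases b <;>
    norm_num at hlow hhigh hmm hexc ⊢ <;> omega


/-- For a finite simple graph with independence number 3 whose reduced
independence polynomial is `P(z) = a₁z + a₂z² + a₃z³`, if `a₁ ≥ 4`,
`4·a₃·(a₁−2)² < a₂²·(a₁−3)`, `a₂² < 4·a₁·a₃`, and `(a₁,a₂,a₃)` is neither `(7,9,3)` nor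
`(8,11,4)`, then the Julia set of `P` is not connected. -/
theorem stmt_9 {V : Type*} [Fintype V] [DecidableEq V]
    (G : SimpleGraph V) [DecidableRel G.Adj]
    (a₁ a₂ a₃ : ℕ)
    (ha₁ : a₁ = Fintype.card V)
    (ha₂ : a₂ = (Finset.univ.filter
      (fun s : Finset V => s.card = 2 ∧ ∀ u ∈ s, ∀ v ∈ s, ¬ G.Adj u v)).card)
    (ha₃ : a₃ = (Finset.univ.filter
      (fun s : Finset V => s.card = 3 ∧ ∀ u ∈ s, ∀ v ∈ s, ¬ G.Adj u v)).card)
    (hindep3 : ∃ s : Finset V, s.card = 3 ∧ ∀ u ∈ s, ∀ v ∈ s, ¬ G.Adj u v)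
    (hindep4 : ¬ ∃ s : Finset V, s.card = 4 ∧ ∀ u ∈ s, ∀ v ∈ s, ¬ G.Adj u v)
    (P : ℂ → ℂ)
    (hP : ∀ z, P z = a₁ * z + a₂ * z ^ 2 + a₃ * z ^ 3)
    (ha : 4 ≤ a₁)
    (hlow : 4 * a₃ * ((a₁ : ℤ) - 2) ^ 2 < (a₂ : ℤ) ^ 2 * ((a₁ : ℤ) - 3))
    (hhigh : a₂ ^ 2 < 4 * a₁ * a₃)
    (hexc : ¬ ((a₁, a₂, a₃) = (7, 9, 3) ∨ (a₁, a₂, a₃) = (8, 11, 4))) :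
    ¬ IsConnected
        (frontier {z : ℂ | Bornology.IsBounded (Set.range fun n => P^[n] z)}) := by
  have hmm := moon_moser G
  rw [← ha₁, ← ha₂, ← ha₃] at hmm
  have hb0 : 0 < a₂ := by
    rcases Nat.eq_zero_or_pos a₂ with h | h
    · subst h
      have : 0 ≤ 4 * (a₃ : ℤ) * ((a₁ : ℤ) - 2) ^ 2 := by positivity
      norm_num at hlow
      omega
    · exact h
  have hc0 : 1 ≤ a₃ := Nat.one_le_iff_ne_zero.mpr fun h => by simp [h] at hhigh
  have hb : (0 : ℝ) < a₂ := by exact_mod_cast hb0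
  have hc : (1 : ℝ) ≤ a₃ := by exact_mod_cast hc0
  have haR : (4 : ℝ) ≤ a₁ := by exact_mod_cast ha
  have hP' : ∀ z, P z = ((a₁ : ℝ) : ℂ) * z + ((a₂ : ℝ) : ℂ) * z ^ 2 + ((a₃ : ℝ) : ℂ) * z ^ 3 := by
    simpa using hP
  have hlowR : 4 * (a₃ : ℝ) * ((a₁ : ℝ) - 2) ^ 2 < (a₂ : ℝ) ^ 2 * ((a₁ : ℝ) - 3) := by
    exact_mod_cast hlow
  have hhighR : (a₂ : ℝ) ^ 2 < 4 * a₁ * a₃ := by exact_mod_cast hhigh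
  have hdisc : 4 * (a₃ : ℝ) * (a₁ - 1) < (a₂ : ℝ) ^ 2 := by
    have h3 : (0 : ℝ) < a₁ - 3 := by linarith
    refine lt_of_mul_lt_mul_right ?_ h3.le
    nlinarith
  rcases nine_le_or_exceptional ha hlow hhigh hmm hexc with h | h | h | h
  · have h9 : (9 : ℝ) ≤ a₁ := by exact_mod_cast h
    have hc' : (0 : ℝ) < a₃ := by linarith
    obtain ⟨k, hk⟩ : ∃ k : ℝ, (a₂ : ℝ) = a₃ * k := ⟨a₂ / a₃, by field_simp⟩
    have hk0 : 0 < k := pos_of_mul_pos_right (hk ▸ hb) hc'.le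
    have hk2 : (a₃ : ℝ) * k ^ 2 < 4 * a₁ := by
      refine lt_of_mul_lt_mul_left ?_ hc'.le
      rw [hk] at hhighR
      linarith
    refine not_isConnected_julia_cubic_of_witness (x := -k / 6) (q := -2 * k / 3)
      haR hb hc hdisc ?_ ?_ ?_ ?_ P hP' <;> rw [hk]
    · nlinarith
    · have : 0 ≤ k * (a₁ / 6 - 5 * (a₃ * k ^ 2) / 216 - 2 / 3) :=
        mul_nonneg hk0.le (by linarith)
      linarith
    · linarith
    · nlinarith
  · obtain ⟨rfl, rfl, rfl⟩ := h
    exact not_isConnected_julia_cubic_of_witness (x := -1 / 3) (q := -11 / 10)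
      haR hb hc hdisc (by norm_num) (by norm_num) (by norm_num) (by norm_num) P hP'
  · obtain ⟨rfl, rfl, rfl⟩ := h
    exact not_isConnected_julia_cubic_of_witness (x := -3 / 10) (q := -21 / 20)
      haR hb hc hdisc (by norm_num) (by norm_num) (by norm_num) (by norm_num) P hP'
  · obtain ⟨rfl, rfl, rfl⟩ := h
    exact not_isConnected_julia_cubic_of_witness (x := -29 / 100) (q := -101 / 100)
      haR hb hc hdisc (by norm_num) (by norm_num) (by norm_num) (by norm_num) P hP'
end

section
/- Let G be a finite simple graph with independence number 3, let a₁ be the number of vertices of G, a₂ the number of 2-element independent sets, and a₃ the number of 3-element independent sets, and let P(z) = a₁z + a₂z² + a₃z³ as a map ℂ → ℂ. Suppose a₂² = 4·a₁·a₃. Then: if a₁ ≤ 9 the Julia set J(P) is connected; if a₁ = 9 then J(P) equals the real segment {x + 0i : δ₁ ≤ x ≤ 0} where δ₁ = −(1 + √a₁)/√a₃ = −4/√a₃; and if a₁ > 9 then J(P) is totally disconnected. -/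
namespace PerfectSquareCubic

open Set Filter Topology

/-- The filled-in Julia set of a self-map of `ℂ`. -/
def filledJulia (P : ℂ → ℂ) : Set ℂ :=
  {z | Bornology.IsBounded (Set.range fun n => P^[n] z)}

/-- The monic cubic `w (w + s)²`. -/
def cubic (s : ℝ) (w : ℂ) : ℂ := w * (w + s) ^ 2

/-- The real segment from `-(s + 1)` to `0`, seen in `ℂ`. -/
def spine (s : ℝ) : Set ℂ := (fun x : ℝ => (x : ℂ)) '' Icc (-(s + 1)) 0

lemma mem_spine_iff {s : ℝ} {w : ℂ} :
    w ∈ spine s ↔ -(s + 1) ≤ w.re ∧ w.re ≤ 0 ∧ w.im = 0 := by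
  constructor
  · rintro ⟨x, ⟨h₁, h₂⟩, rfl⟩
    exact ⟨by simpa using h₁, by simpa using h₂, by simp⟩
  · rintro ⟨h₁, h₂, h₃⟩
    exact ⟨w.re, ⟨h₁, h₂⟩, Complex.ext (by simp) (by simp [h₃])⟩

lemma cubic_ofReal (s x : ℝ) : cubic s x = ((x * (x + s) ^ 2 : ℝ) : ℂ) := by
  simp [cubic]

lemma continuous_cubic (s : ℝ) : Continuous (cubic s) := by
  unfold cubic; fun_prop

lemma continuous_cubic_iterate (s : ℝ) (n : ℕ) : Continuous (cubic s)^[n] :=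
  (continuous_cubic s).iterate n

lemma cubic_mem_spine {s : ℝ} (hs : 0 < s) (hs3 : s ≤ 3) {w : ℂ} (hw : w ∈ spine s) :
    cubic s w ∈ spine s := by
  obtain ⟨x, ⟨h₁, h₂⟩, rfl⟩ := hw
  refine ⟨x * (x + s) ^ 2, ⟨?_, mul_nonpos_of_nonpos_of_nonneg h₂ (sq_nonneg _)⟩,
    (cubic_ofReal s x).symm⟩
  have key : x * (x + s) ^ 2 + (s + 1) = (x + (s + 1)) * (x ^ 2 + (s - 1) * x + 1) := by ring
  have : 0 ≤ x ^ 2 + (s - 1) * x + 1 := by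
    nlinarith [sq_nonneg (x + (s - 1) / 2), mul_nonneg (sub_nonneg.2 hs3) (by linarith : 0 ≤ s + 1)]
  nlinarith [mul_nonneg (by linarith : 0 ≤ x + (s + 1)) this]

lemma iterate_mem_spine {s : ℝ} (hs : 0 < s) (hs3 : s ≤ 3) {w : ℂ} (hw : w ∈ spine s) (n : ℕ) :
    (cubic s)^[n] w ∈ spine s := by
  induction n with
  | zero => exact hw
  | succ n ih => rw [Function.iterate_succ_apply']; exact cubic_mem_spine hs hs3 ih

lemma norm_le_of_mem_spine {s : ℝ} {w : ℂ} (hw : w ∈ spine s) : ‖w‖ ≤ s + 1 := by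
  obtain ⟨x, ⟨h₁, h₂⟩, rfl⟩ := hw
  simp only [Complex.norm_real, Real.norm_eq_abs]
  rw [abs_of_nonpos h₂]; linarith

lemma zero_mem_spine {s : ℝ} (hs : 0 < s) : (0 : ℂ) ∈ spine s :=
  mem_spine_iff.2 ⟨by simp; linarith, by simp, by simp⟩

lemma four_mul_norm_le_norm_cubic {s : ℝ} (hs : 0 < s) {w : ℂ} (hw : s + 2 ≤ ‖w‖) :
    4 * ‖w‖ ≤ ‖cubic s w‖ := by
  have h : 2 ≤ ‖w + s‖ := by
    have := norm_sub_le (w + s) (s : ℂ)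
    rw [add_sub_cancel_right, Complex.norm_real, Real.norm_of_nonneg hs.le] at this
    linarith
  rw [cubic, norm_mul, norm_pow]
  nlinarith [norm_nonneg w, mul_nonneg (norm_nonneg w) (by nlinarith : 0 ≤ ‖w + s‖ ^ 2 - 4)]

lemma pow_mul_norm_le_norm_iterate {s : ℝ} (hs : 0 < s) {w : ℂ} (hw : s + 2 ≤ ‖w‖) (n : ℕ) :
    4 ^ n * ‖w‖ ≤ ‖(cubic s)^[n] w‖ := by
  induction n with
  | zero => simp
  | succ n ih =>
    have h1 : (1 : ℝ) ≤ 4 ^ n := one_le_pow₀ (by norm_num)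
    have := four_mul_norm_le_norm_cubic hs (w := (cubic s)^[n] w)
      (by nlinarith [norm_nonneg w])
    rw [Function.iterate_succ_apply', pow_succ]
    linarith

lemma norm_iterate_mono {s : ℝ} (hs : 0 < s) {w : ℂ} {m n : ℕ} (hmn : m ≤ n)
    (hw : s + 2 ≤ ‖(cubic s)^[m] w‖) : ‖(cubic s)^[m] w‖ ≤ ‖(cubic s)^[n] w‖ := by
  obtain ⟨k, rfl⟩ := Nat.exists_eq_add_of_le hmn
  have h1 : (1 : ℝ) ≤ 4 ^ k := one_le_pow₀ (by norm_num)
  have := pow_mul_norm_le_norm_iterate hs hw k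
  rw [add_comm, Function.iterate_add_apply]
  nlinarith [norm_nonneg ((cubic s)^[m] w)]

lemma mem_filledJulia_cubic_iff {s : ℝ} (hs : 0 < s) {w : ℂ} :
    w ∈ filledJulia (cubic s) ↔ ∀ n, ‖(cubic s)^[n] w‖ < s + 2 := by
  constructor
  · intro h n
    by_contra! hn
    obtain ⟨C, hC⟩ := isBounded_iff_forall_norm_le.1
      (show Bornology.IsBounded (range fun n => (cubic s)^[n] w) from h)
    obtain ⟨k, hk⟩ := pow_unbounded_of_one_lt C (by norm_num : (1 : ℝ) < 4)
    have h1 := pow_mul_norm_le_norm_iterate hs hn k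
    rw [← Function.iterate_add_apply] at h1
    have h2 := hC _ ⟨k + n, rfl⟩
    have h3 : (0 : ℝ) < 4 ^ k := by positivity
    simp only at h2
    nlinarith
  · intro h
    change Bornology.IsBounded (range fun n => (cubic s)^[n] w)
    refine isBounded_iff_forall_norm_le.2 ⟨s + 2, ?_⟩
    rintro _ ⟨n, rfl⟩
    exact (h n).le

lemma filledJulia_cubic_eq {s : ℝ} (hs : 0 < s) :
    filledJulia (cubic s) = ⋂ n, {w | ‖(cubic s)^[n] w‖ ≤ s + 2} := by
  ext w
  rw [mem_filledJulia_cubic_iff hs, mem_iInter]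
  refine ⟨fun h n => (h n).le, fun h n => lt_of_not_ge fun hn => ?_⟩
  have h1 := four_mul_norm_le_norm_cubic hs hn
  rw [← Function.iterate_succ_apply' (cubic s)] at h1
  have h2 : ‖(cubic s)^[n + 1] w‖ ≤ s + 2 := h (n + 1)
  linarith

lemma isClosed_filledJulia_cubic {s : ℝ} (hs : 0 < s) : IsClosed (filledJulia (cubic s)) := by
  rw [filledJulia_cubic_eq hs]
  exact isClosed_iInter fun n =>
    isClosed_le (continuous_cubic_iterate s n).norm continuous_const

lemma add_div_mem_slitPlane {s : ℝ} (hs : 0 < s) {w : ℂ} (hw : w ∉ spine s) :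
    (w + s) / w ∈ Complex.slitPlane := by
  have hw0 : w ≠ 0 := fun h => hw (h ▸ zero_mem_spine hs)
  by_contra h
  rw [Complex.mem_slitPlane_iff] at h
  push Not at h
  obtain ⟨hre, him⟩ := h
  set r := ((w + s) / w).re with hr
  have hr' : (w + s) / w = (r : ℂ) := Complex.ext (by simp [hr]) (by simp [him])
  rw [div_eq_iff hw0] at hr'
  have h1 : (1 : ℝ) - r ≠ 0 := by linarith
  have h2 : ((1 : ℂ) - r) ≠ 0 := by exact_mod_cast h1
  have h3 : w = ((-s / (1 - r) : ℝ) : ℂ) := by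
    push_cast
    rw [eq_div_iff h2]
    linear_combination hr'
  refine hw ⟨-s / (1 - r), ⟨?_, ?_⟩, h3.symm⟩
  · rw [le_div_iff₀ (by linarith)]; nlinarith
  · exact div_nonpos_of_nonpos_of_nonneg (by linarith) (by linarith)

/-- Off the preimage of the spine, the `n`-th iterate is `x ^ 3 ^ n` times a function with a
continuous logarithm. -/
lemma exists_iterate_eq_pow_mul_exp {s : ℝ} (hs : 0 < s) (hs3 : s ≤ 3) (n : ℕ) :
    ∃ v : ℂ → ℂ, ContinuousOn v {x | (cubic s)^[n] x ∉ spine s} ∧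
      ∀ x, (cubic s)^[n] x ∉ spine s → (cubic s)^[n] x = x ^ 3 ^ n * Complex.exp (v x) := by
  induction n with
  | zero => exact ⟨fun _ => 0, continuousOn_const, fun x _ => by simp⟩
  | succ n ih =>
    obtain ⟨v, hv, hvx⟩ := ih
    have hsub : ∀ x, (cubic s)^[n + 1] x ∉ spine s → (cubic s)^[n] x ∉ spine s := fun x hx h =>
      hx (by rw [Function.iterate_succ_apply']; exact cubic_mem_spine hs hs3 h)
    refine ⟨fun x => 3 * v x + 2 * Complex.log (((cubic s)^[n] x + s) / (cubic s)^[n] x),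
      ?_, fun x hx => ?_⟩
    · have hne : ∀ x ∈ {x | (cubic s)^[n + 1] x ∉ spine s}, (cubic s)^[n] x ≠ 0 :=
        fun x hx h => hsub x hx (h ▸ zero_mem_spine hs)
      have hc := (continuous_cubic_iterate s n).continuousOn
        (s := {x | (cubic s)^[n + 1] x ∉ spine s})
      refine (continuousOn_const.mul (hv.mono hsub)).add (continuousOn_const.mul
        (ContinuousOn.clog ((hc.add continuousOn_const).div hc hne) fun x hx =>
          add_div_mem_slitPlane hs (hsub x hx)))
    · have hy := hsub x hx
      have hslit := add_div_mem_slitPlane hs hy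
      rw [Complex.exp_add, mul_comm (2 : ℂ), mul_comm (3 : ℂ),
        show v x * 3 = ((3 : ℕ) : ℂ) * v x by push_cast; ring, Complex.exp_nat_mul,
        show ∀ z : ℂ, z * 2 = ((2 : ℕ) : ℂ) * z by intro z; push_cast; ring, Complex.exp_nat_mul,
        Complex.exp_log (Complex.slitPlane_ne_zero hslit), Function.iterate_succ_apply', pow_succ,
        pow_mul, ← mul_assoc, ← mul_pow, ← hvx x hy, cubic]
      have hy0 : (cubic s)^[n] x ≠ 0 := fun h => hy (h ▸ zero_mem_spine hs)
      field_simp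

/-- The polynomial underlying `cubic s`. -/
noncomputable def cubicPoly (s : ℝ) : Polynomial ℂ :=
  Polynomial.X * (Polynomial.X + Polynomial.C (s : ℂ)) ^ 2

lemma eval_cubicPoly (s : ℝ) (w : ℂ) : (cubicPoly s).eval w = cubic s w := by
  simp [cubicPoly, cubic]

lemma natDegree_cubicPoly (s : ℝ) : (cubicPoly s).natDegree = 3 := by
  rw [cubicPoly, Polynomial.monic_X.natDegree_mul ((Polynomial.monic_X_add_C _).pow 2),
    (Polynomial.monic_X_add_C _).natDegree_pow]
  simp

lemma cubic_surjective (s : ℝ) : Function.Surjective (cubic s) := fun y => by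
  have hdeg : (cubicPoly s - Polynomial.C y).degree ≠ 0 := by
    apply ne_of_gt
    rw [← Polynomial.natDegree_pos_iff_degree_pos, Polynomial.natDegree_sub_C,
      natDegree_cubicPoly]
    norm_num
  obtain ⟨x, hx⟩ := IsAlgClosed.exists_root _ hdeg
  refine ⟨x, ?_⟩
  rw [Polynomial.IsRoot, Polynomial.eval_sub, Polynomial.eval_C, eval_cubicPoly] at hx
  exact sub_eq_zero.1 hx

/-- The critical values of the cubic lie on the spine, so it is a covering map off the spine. -/
lemma isCoveringMapOn_cubic {s : ℝ} (hs : 0 < s) (hs3 : s ≤ 3) :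
    IsCoveringMapOn (cubic s) (spine s)ᶜ := by
  have h := (cubicPoly s).isCoveringMapOn_eval
  rw [show (fun x => (cubicPoly s).eval x) = cubic s from funext (eval_cubicPoly s)] at h
  refine h.mono ?_
  rw [compl_subset_compl]
  rintro _ ⟨k, hk, rfl⟩
  refine cubic_mem_spine hs hs3 ?_
  have hk' : (k + s) * (3 * k + s) = 0 := by
    have : Polynomial.eval k (Polynomial.derivative (cubicPoly s)) = 0 := hk
    simp [cubicPoly, Polynomial.derivative_pow] at this
    linear_combination this
  rcases mul_eq_zero.1 hk' with h | h
  · exact ⟨-s, ⟨by linarith, by linarith⟩, by push_cast; linear_combination -h⟩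
  · exact ⟨-s / 3, ⟨by linarith, by linarith⟩, by push_cast; linear_combination -h / 3⟩

/-- The equipotential approximations to the Julia set. -/
def levelCurve (s : ℝ) (n : ℕ) : Set ℂ := {x | ‖(cubic s)^[n] x‖ = s + 2}

lemma notMem_spine_of_norm_eq {s : ℝ} {w : ℂ} (hw : ‖w‖ = s + 2) : w ∉ spine s := fun h => by
  have := norm_le_of_mem_spine h; linarith

lemma norm_circle {s : ℝ} (hs : 0 < s) (θ : ℝ) :
    ‖((s + 2 : ℝ) : ℂ) * Complex.exp (θ * Complex.I)‖ = s + 2 := by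
  rw [norm_mul, Complex.norm_exp_ofReal_mul_I, mul_one, Complex.norm_real,
    Real.norm_of_nonneg (by linarith)]

lemma exists_circle_lift {s : ℝ} (hs : 0 < s) (hs3 : s ≤ 3) (n : ℕ) :
    ∃ γ : C(ℝ, ℂ), ∀ θ : ℝ,
      (cubic s)^[n] (γ θ) = ((s + 2 : ℝ) : ℂ) * Complex.exp (θ * Complex.I) := by
  induction n with
  | zero => exact ⟨⟨fun θ => ((s + 2 : ℝ) : ℂ) * Complex.exp (θ * Complex.I), by fun_prop⟩,
      fun θ => rfl⟩
  | succ n ih =>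
    obtain ⟨γ, hγ⟩ := ih
    obtain ⟨e, he⟩ := cubic_surjective s (γ 0)
    obtain ⟨F, ⟨-, hF⟩, -⟩ := (isCoveringMapOn_cubic hs hs3).existsUnique_continuousMap_lifts γ he
      fun θ h => notMem_spine_of_norm_eq (norm_circle hs θ)
        (hγ θ ▸ iterate_mem_spine hs hs3 h n)
    refine ⟨F, fun θ => ?_⟩
    rw [Function.iterate_succ_apply, ← hγ θ]
    exact congrArg _ (congrFun hF θ)

lemma eqOn_of_pow_eq_const {h : ℝ → ℂ} (hc : Continuous h) {m : ℕ} (hm : m ≠ 0) {c : ℂ}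
    (hpow : ∀ t, h t ^ m = c) (a b : ℝ) : h a = h b := by
  have hfin : {z : ℂ | z ^ m = c}.Finite := by
    have hp : (Polynomial.X ^ m - Polynomial.C c : Polynomial ℂ) ≠ 0 :=
      Polynomial.X_pow_sub_C_ne_zero (Nat.pos_of_ne_zero hm) c
    refine (Polynomial.X ^ m - Polynomial.C c : Polynomial ℂ).roots.toFinset.finite_toSet.subset ?_
    intro z hz
    have : z ^ m = c := hz
    simp [Polynomial.mem_roots hp, Polynomial.IsRoot, this]
  exact hfin.countable.isTotallyDisconnected _ (range_subset_iff.2 hpow)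
    (isPreconnected_range hc) (mem_range_self a) (mem_range_self b)

lemma lift_monodromy {s : ℝ} (hs : 0 < s) (hs3 : s ≤ 3) {n : ℕ} {γ : C(ℝ, ℂ)}
    (hγ : ∀ θ : ℝ, (cubic s)^[n] (γ θ) = ((s + 2 : ℝ) : ℂ) * Complex.exp (θ * Complex.I))
    {a b : ℝ} (hab : γ a = γ b) : ∃ k : ℤ, a = b + k * (3 ^ n * (2 * Real.pi)) := by
  obtain ⟨v, hv, hvx⟩ := exists_iterate_eq_pow_mul_exp hs hs3 n
  have hmem : ∀ θ, (cubic s)^[n] (γ θ) ∉ spine s := fun θ => by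
    rw [hγ]; exact notMem_spine_of_norm_eq (norm_circle hs θ)
  have hvc : Continuous fun θ => v (γ θ) := hv.comp_continuous γ.continuous hmem
  have hm : (3 : ℂ) ^ n ≠ 0 := pow_ne_zero n (by norm_num)
  set h : ℝ → ℂ := fun θ =>
    γ θ * Complex.exp (v (γ θ) / 3 ^ n) * Complex.exp (-(θ * Complex.I) / 3 ^ n) with hh
  have hc : Continuous h :=
    (γ.continuous.mul (Complex.continuous_exp.comp (hvc.div_const _))).mul
      (Complex.continuous_exp.comp
        ((Complex.continuous_ofReal.mul continuous_const).neg.div_const _))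
  have hpow : ∀ θ, h θ ^ 3 ^ n = ((s + 2 : ℝ) : ℂ) := fun θ => by
    have h1 := hvx _ (hmem θ)
    rw [hγ] at h1
    rw [hh]
    simp only [mul_pow, ← Complex.exp_nat_mul]
    push_cast
    rw [mul_div_cancel₀ _ hm, mul_div_cancel₀ _ hm, ← h1, mul_assoc, ← Complex.exp_add]
    simp
  have key := eqOn_of_pow_eq_const hc (by positivity) hpow a b
  have hne : γ b ≠ 0 := fun h0 => hmem b <| by
    rw [h0]; exact iterate_mem_spine hs hs3 (zero_mem_spine hs) n
  simp only [hh, hab] at key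
  have key' := mul_left_cancel₀ (mul_ne_zero hne (Complex.exp_ne_zero _)) key
  obtain ⟨k, hk⟩ := Complex.exp_eq_exp_iff_exists_int.1 key'
  refine ⟨-k, ?_⟩
  field_simp at hk
  have h2 : (a : ℂ) = b + (-k : ℤ) * (3 ^ n * (2 * Real.pi)) := by
    push_cast
    linear_combination -hk
  exact_mod_cast h2

lemma iterate_fiber_card_le {s : ℝ} {n : ℕ} {y : ℂ} (t : Finset ℂ)
    (ht : ∀ x ∈ t, (cubic s)^[n] x = y) : t.card ≤ 3 ^ n := by
  classical
  set p : Polynomial ℂ := (cubicPoly s).comp^[n] Polynomial.X with hp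
  have hdeg : p.natDegree = 3 ^ n := by
    rw [hp, Polynomial.natDegree_iterate_comp, natDegree_cubicPoly]; simp
  have heval : ∀ x, p.eval x = (cubic s)^[n] x := fun x => by
    rw [hp, Polynomial.iterate_comp_eval, Polynomial.eval_X,
      show (fun x => (cubicPoly s).eval x) = cubic s from funext (eval_cubicPoly s)]
  have hdeg' : (p - Polynomial.C y).natDegree = 3 ^ n := by
    rw [Polynomial.natDegree_sub_C, hdeg]
  have hne : p - Polynomial.C y ≠ 0 := fun h => by
    rw [h] at hdeg'; simp at hdeg'
    exact absurd hdeg'.symm (by positivity)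
  rw [← hdeg']
  refine Polynomial.card_le_degree_of_subset_roots fun x hx => ?_
  rw [Polynomial.mem_roots hne, Polynomial.IsRoot]
  simp [heval, ht x hx]

lemma levelCurve_eq_range {s : ℝ} (hs : 0 < s) (hs3 : s ≤ 3) {n : ℕ} {γ : C(ℝ, ℂ)}
    (hγ : ∀ θ : ℝ, (cubic s)^[n] (γ θ) = ((s + 2 : ℝ) : ℂ) * Complex.exp (θ * Complex.I)) :
    levelCurve s n = range γ := by
  classical
  apply Subset.antisymm
  · intro x hx
    have hx' : ‖(cubic s)^[n] x‖ = s + 2 := hx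
    by_contra hxr
    set θ := Complex.arg ((cubic s)^[n] x) with hθ
    have hxθ : (cubic s)^[n] x = ((s + 2 : ℝ) : ℂ) * Complex.exp (θ * Complex.I) := by
      rw [← hx', hθ, Complex.norm_mul_exp_arg_mul_I]
    set T : Finset ℂ :=
      (Finset.range (3 ^ n)).image fun k : ℕ => γ (θ + k * (2 * Real.pi)) with hT
    have hcard : T.card = 3 ^ n := by
      rw [hT, Finset.card_image_of_injOn, Finset.card_range]
      intro i hi j hj hij
      simp only [Finset.coe_range, mem_Iio] at hi hj
      obtain ⟨k, hk⟩ := lift_monodromy hs hs3 hγ hij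
      have h1 : (i : ℝ) = j + k * 3 ^ n := by
        have := Real.pi_ne_zero
        have h2 : (2 * Real.pi) * (i : ℝ) = (2 * Real.pi) * (j + k * 3 ^ n) := by linarith
        exact mul_left_cancel₀ (by positivity) h2
      have h2 : (i : ℤ) = j + k * ((3 ^ n : ℕ) : ℤ) := by
        push_cast; exact_mod_cast h1
      have h3 : (i : ℤ) % ((3 ^ n : ℕ) : ℤ) = (j : ℤ) % ((3 ^ n : ℕ) : ℤ) := by
        rw [h2, Int.add_mul_emod_self_right]
      rw [Int.emod_eq_of_lt (by positivity) (by exact_mod_cast hi),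
        Int.emod_eq_of_lt (by positivity) (by exact_mod_cast hj)] at h3
      exact_mod_cast h3
    have hxT : x ∉ T := fun h => by
      obtain ⟨k, -, hk⟩ := Finset.mem_image.1 h
      exact hxr ⟨_, hk⟩
    have := iterate_fiber_card_le (s := s) (n := n)
      (y := ((s + 2 : ℝ) : ℂ) * Complex.exp (θ * Complex.I)) (insert x T) (by
        intro z hz
        rcases Finset.mem_insert.1 hz with rfl | hz
        · exact hxθ
        · obtain ⟨k, -, rfl⟩ := Finset.mem_image.1 hz
          rw [hγ]
          congr 1
          rw [Complex.exp_eq_exp_iff_exists_int]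
          exact ⟨k, by push_cast; ring⟩)
    rw [Finset.card_insert_of_notMem hxT, hcard] at this
    omega
  · rintro _ ⟨θ, rfl⟩
    change ‖_‖ = _
    rw [hγ, norm_circle hs]

lemma isPreconnected_levelCurve {s : ℝ} (hs : 0 < s) (hs3 : s ≤ 3) (n : ℕ) :
    IsPreconnected (levelCurve s n) := by
  obtain ⟨γ, hγ⟩ := exists_circle_lift hs hs3 n
  rw [levelCurve_eq_range hs hs3 hγ]
  exact isPreconnected_range γ.continuous

lemma eventually_levelCurve_inter_nonempty {s : ℝ} (hs : 0 < s) {p : ℂ}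
    (hp : p ∈ frontier (filledJulia (cubic s))) {U : Set ℂ} (hU : U ∈ 𝓝 p) :
    ∀ᶠ n in atTop, (levelCurve s n ∩ U).Nonempty := by
  obtain ⟨ε, hε, hball⟩ := Metric.mem_nhds_iff.1 hU
  have hpK : p ∈ filledJulia (cubic s) := (isClosed_filledJulia_cubic hs).frontier_subset hp
  rw [frontier_eq_closure_inter_closure] at hp
  obtain ⟨y, hy, hyK⟩ := mem_closure_iff.1 hp.2 _ Metric.isOpen_ball (Metric.mem_ball_self hε)
  have hy' : ¬ ∀ n, ‖(cubic s)^[n] y‖ < s + 2 := fun h => hyK ((mem_filledJulia_cubic_iff hs).2 h)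
  push Not at hy'
  obtain ⟨n₀, hn₀⟩ := hy'
  filter_upwards [eventually_ge_atTop n₀] with n hn
  obtain ⟨x, hx, hxn⟩ := (convex_ball p ε).isPreconnected.intermediate_value
    (Metric.mem_ball_self hε) hy (continuous_cubic_iterate s n).norm.continuousOn
    ⟨((mem_filledJulia_cubic_iff hs).1 hpK n).le, hn₀.trans (norm_iterate_mono hs hn hn₀)⟩
  exact ⟨x, hxn, hball hx⟩

lemma eventually_levelCurve_subset {s : ℝ} (hs : 0 < s) {W : Set ℂ} (hW : IsOpen W)
    (hJ : frontier (filledJulia (cubic s)) ⊆ W) : ∀ᶠ n in atTop, levelCurve s n ⊆ W := by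
  have hcomp : IsCompact (Metric.closedBall (0 : ℂ) (s + 2) \ W) :=
    (isCompact_closedBall _ _).diff hW
  have hev : ∀ᶠ n in atTop, ∀ x ∈ Metric.closedBall (0 : ℂ) (s + 2) \ W, x ∉ levelCurve s n := by
    refine hcomp.induction_on (p := fun X => ∀ᶠ n in atTop, ∀ x ∈ X, x ∉ levelCurve s n)
      (by simp) (fun X Y hXY hY => hY.mono fun n hn x hx => hn x (hXY hx))
      (fun X Y hX hY => ?_) fun p hp => ?_
    · filter_upwards [hX, hY] with n h1 h2 x hx
      exact hx.elim (h1 x) (h2 x)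
    · by_cases hpK : p ∈ filledJulia (cubic s)
      · have hint : p ∈ interior (filledJulia (cubic s)) := by
          by_contra h
          exact hp.2 (hJ ⟨subset_closure hpK, h⟩)
        refine ⟨_, mem_nhdsWithin_of_mem_nhds (mem_interior_iff_mem_nhds.1 hint),
          Eventually.of_forall fun n x hx h => ?_⟩
        have := (mem_filledJulia_cubic_iff hs).1 hx n
        exact this.ne h
      · rw [filledJulia_cubic_eq hs, mem_iInter] at hpK
        push Not at hpK
        obtain ⟨n₀, hn₀⟩ := hpK
        have hn₀' : s + 2 < ‖(cubic s)^[n₀] p‖ := not_le.1 hn₀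
        have hopen : IsOpen {x | s + 2 < ‖(cubic s)^[n₀] x‖} :=
          isOpen_lt continuous_const (continuous_cubic_iterate s n₀).norm
        refine ⟨_, mem_nhdsWithin_of_mem_nhds (hopen.mem_nhds hn₀'), ?_⟩
        filter_upwards [eventually_ge_atTop n₀] with n hn x hx h
        have hx' : s + 2 < ‖(cubic s)^[n₀] x‖ := hx
        have h' : ‖(cubic s)^[n] x‖ = s + 2 := h
        have := norm_iterate_mono hs hn hx'.le
        linarith
  filter_upwards [hev] with n hn x hx
  by_contra hxW
  refine hn x ⟨?_, hxW⟩ hx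
  rw [mem_closedBall_zero_iff]
  by_contra! hlt
  have h0 : s + 2 ≤ ‖(cubic s)^[0] x‖ := hlt.le
  have h1 := norm_iterate_mono hs (Nat.zero_le n) h0
  have hx' : ‖(cubic s)^[n] x‖ = s + 2 := hx
  simp only [Function.iterate_zero, id] at h1
  linarith

theorem isConnected_frontier_filledJulia_cubic {s : ℝ} (hs : 0 < s) (hs3 : s ≤ 3) :
    IsConnected (frontier (filledJulia (cubic s))) := by
  constructor
  · rw [nonempty_frontier_iff]
    refine ⟨⟨0, (mem_filledJulia_cubic_iff hs).2 fun n => ?_⟩, fun h => ?_⟩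
    · have := norm_le_of_mem_spine (iterate_mem_spine hs hs3 (zero_mem_spine hs) n)
      linarith
    · have := (mem_filledJulia_cubic_iff hs).1 (h ▸ mem_univ ((s + 2 : ℝ) : ℂ)) 0
      simp only [Function.iterate_zero, id, Complex.norm_real] at this
      exact absurd (Real.le_norm_self _) (not_le.2 this)
  · rw [isPreconnected_iff_subset_of_fully_disjoint_closed isClosed_frontier]
    intro u v hu hv huv hdisj
    by_contra! hcon
    obtain ⟨p, hp, hpu⟩ := not_subset.1 hcon.1
    obtain ⟨q, hq, hqv⟩ := not_subset.1 hcon.2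
    have hpv := (huv hp).resolve_left hpu
    have hqu := (huv hq).resolve_right hqv
    obtain ⟨U, V, hU, hV, huU, hvV, hUV⟩ := normal_separation hu hv hdisj
    obtain ⟨n, hn, hnp, hnq⟩ := ((eventually_levelCurve_subset hs (hU.union hV)
      (huv.trans (union_subset_union huU hvV))).and
      ((eventually_levelCurve_inter_nonempty hs hp (hV.mem_nhds (hvV hpv))).and
      (eventually_levelCurve_inter_nonempty hs hq (hU.mem_nhds (huU hqu))))).exists
    obtain ⟨x, -, hxU, hxV⟩ := isPreconnected_levelCurve hs hs3 n U V hU hV hn hnq hnp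
    exact disjoint_left.1 hUV hxU hxV

lemma norm_add_ofReal_sq (w : ℂ) (x : ℝ) :
    ‖w + x‖ ^ 2 = ‖w‖ ^ 2 + 2 * x * w.re + x ^ 2 := by
  rw [Complex.sq_norm, Complex.sq_norm, Complex.normSq_apply, Complex.normSq_apply]
  simp
  ring

lemma le_norm_quadratic {b : ℝ} (hb : 2 ≤ b) (w : ℂ) :
    ‖w‖ ^ 2 + b * w.re + 1 ≤ ‖w ^ 2 + b * w + 1‖ := by
  refine le_of_sq_le_sq ?_ (norm_nonneg _)
  rw [Complex.sq_norm, Complex.sq_norm, Complex.normSq_apply, Complex.normSq_apply]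
  simp [pow_two]
  nlinarith [mul_nonneg (by nlinarith : 0 ≤ b ^ 2 - 4) (sq_nonneg w.im)]

/-- The sum of the distances to the endpoints of the spine. -/
noncomputable def focalSum (s : ℝ) (w : ℂ) : ℝ := ‖w‖ + ‖w + ((s + 1 : ℝ) : ℂ)‖

lemma five_mul_focalSum_le {s : ℝ} (hs : 3 ≤ s) (w : ℂ) :
    5 * (focalSum s w - (s + 1)) ≤ focalSum s (cubic s w) - (s + 1) := by
  have hQ : cubic s w + ((s + 1 : ℝ) : ℂ) =
      (w + ((s + 1 : ℝ) : ℂ)) * (w ^ 2 + ((s - 1 : ℝ) : ℂ) * w + 1) := by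
    rw [cubic]; push_cast; ring
  have h1 := norm_add_ofReal_sq w (s + 1)
  have h2 := norm_add_ofReal_sq w s
  have h3 := le_norm_quadratic (by linarith : 2 ≤ s - 1) w
  have hA := norm_nonneg w
  have hB := norm_nonneg (w + ((s + 1 : ℝ) : ℂ))
  have htri : s + 1 ≤ ‖w‖ + ‖w + ((s + 1 : ℝ) : ℂ)‖ := by
    have := norm_sub_le (w + ((s + 1 : ℝ) : ℂ)) w
    rw [add_sub_cancel_left, Complex.norm_real, Real.norm_of_nonneg (by linarith)] at this
    linarith
  rw [focalSum, focalSum, hQ, cubic, norm_mul, norm_pow, norm_mul, h2]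
  set A := ‖w‖
  set B := ‖w + ((s + 1 : ℝ) : ℂ)‖
  have hx : w.re = (B ^ 2 - A ^ 2 - (s + 1) ^ 2) / (2 * (s + 1)) := by
    field_simp; linarith
  have h4 := mul_le_mul_of_nonneg_left h3 hB
  have key : A * (A ^ 2 + 2 * s * w.re + s ^ 2) + B * (A ^ 2 + (s - 1) * w.re + 1) - (s + 1) =
      (A + B - (s + 1)) *
        ((A ^ 2 + (s + 1) / 2 * (A * B) + (s - 1) / 2 * B ^ 2) / (s + 1) +
          A + (s - 1) / 2 * B + 1) := by
    rw [hx]; field_simp; ring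
  have hH : 5 ≤ (A ^ 2 + (s + 1) / 2 * (A * B) + (s - 1) / 2 * B ^ 2) / (s + 1) +
      A + (s - 1) / 2 * B + 1 := by
    have : 0 ≤ (A ^ 2 + (s + 1) / 2 * (A * B) + (s - 1) / 2 * B ^ 2) / (s + 1) := by
      have : 0 ≤ s - 1 := by linarith
      positivity
    nlinarith
  nlinarith [mul_le_mul_of_nonneg_left hH (sub_nonneg.2 htri)]

lemma mem_spine_of_focalSum_le {s : ℝ} {w : ℂ} (h : focalSum s w ≤ s + 1) : w ∈ spine s := by
  rw [focalSum] at h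
  have h1 := norm_add_ofReal_sq w (s + 1)
  have hA := norm_nonneg w
  have hB := norm_nonneg (w + ((s + 1 : ℝ) : ℂ))
  have h2 : ‖w‖ ^ 2 = w.re ^ 2 + w.im ^ 2 := by
    rw [Complex.sq_norm, Complex.normSq_apply]; ring
  set A := ‖w‖
  set B := ‖w + ((s + 1 : ℝ) : ℂ)‖
  rcases hA.eq_or_lt with hA0 | hA0
  · have hw : w = 0 := norm_eq_zero.1 hA0.symm
    subst hw
    exact mem_spine_iff.2 ⟨by simp; linarith, by simp, by simp⟩
  · have hs1 : 0 < s + 1 := by linarith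
    have h3 : w.re ≤ -A := by
      have : B ^ 2 ≤ (s + 1 - A) ^ 2 := pow_le_pow_left₀ hB (by linarith) 2
      nlinarith
    refine mem_spine_iff.2 ⟨?_, by linarith, ?_⟩
    · have := Complex.abs_re_le_norm w
      have := neg_abs_le w.re
      linarith
    · have : w.im ^ 2 ≤ 0 := by nlinarith
      exact pow_eq_zero_iff (two_ne_zero) |>.1 (le_antisymm this (sq_nonneg _))

lemma filledJulia_cubic_subset_spine {s : ℝ} (hs : 3 ≤ s) :
    filledJulia (cubic s) ⊆ spine s := by
  intro w hw
  rw [mem_filledJulia_cubic_iff (by linarith)] at hw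
  by_contra h
  have hpos : 0 < focalSum s w - (s + 1) :=
    sub_pos.2 (lt_of_not_ge fun h' => h (mem_spine_of_focalSum_le h'))
  have hgrow : ∀ n, 5 ^ n * (focalSum s w - (s + 1)) ≤ focalSum s ((cubic s)^[n] w) - (s + 1) := by
    intro n
    induction n with
    | zero => simp
    | succ n ih =>
      rw [Function.iterate_succ_apply', pow_succ]
      linarith [five_mul_focalSum_le hs ((cubic s)^[n] w)]
  obtain ⟨n, hn⟩ := pow_unbounded_of_one_lt ((2 * (s + 2)) / (focalSum s w - (s + 1)))
    (by norm_num : (1 : ℝ) < 5)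
  rw [div_lt_iff₀ hpos] at hn
  have h1 := hgrow n
  have h2 := norm_add_le ((cubic s)^[n] w) ((s + 1 : ℝ) : ℂ)
  rw [Complex.norm_real, Real.norm_of_nonneg (by linarith)] at h2
  have h3 := hw n
  rw [focalSum.eq_def s ((cubic s)^[n] w)] at h1
  linarith

lemma frontier_eq_self_of_subset_spine {s : ℝ} {K : Set ℂ} (hK : IsClosed K) (h : K ⊆ spine s) :
    frontier K = K := by
  rw [hK.frontier_eq, sdiff_eq_left, disjoint_right]
  intro p hp _
  obtain ⟨ε, hε, hball⟩ := Metric.mem_nhds_iff.1 (mem_interior_iff_mem_nhds.1 hp)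
  have h1 := (mem_spine_iff.1 (h (interior_subset hp))).2.2
  have hmem : p + ((ε / 2 : ℝ) : ℂ) * Complex.I ∈ Metric.ball p ε := by
    rw [Metric.mem_ball, dist_eq_norm, add_sub_cancel_left, norm_mul, Complex.norm_I, mul_one,
      Complex.norm_real, Real.norm_of_nonneg (by positivity)]
    linarith
  have h2 := (mem_spine_iff.1 (h (hball hmem))).2.2
  simp [h1] at h2
  exact hε.ne' h2

theorem frontier_filledJulia_cubic_three :
    frontier (filledJulia (cubic 3)) = spine 3 := by
  have hsub := filledJulia_cubic_subset_spine (le_refl 3)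
  rw [frontier_eq_self_of_subset_spine (isClosed_filledJulia_cubic (by norm_num)) hsub]
  refine hsub.antisymm fun w hw => (mem_filledJulia_cubic_iff (by norm_num)).2 fun n => ?_
  have := norm_le_of_mem_spine (iterate_mem_spine (by norm_num) le_rfl hw n)
  linarith

/-- The odd cubic `s u - u³`, semiconjugate to `cubic s` through `u ↦ -u²`. -/
def oddCubic (s u : ℝ) : ℝ := s * u - u ^ 3

lemma continuous_oddCubic (s : ℝ) : Continuous (oddCubic s) := by
  unfold oddCubic; fun_prop

lemma semiconj_oddCubic (s : ℝ) :
    Function.Semiconj (fun u : ℝ => ((-u ^ 2 : ℝ) : ℂ)) (oddCubic s) (cubic s) := fun u => by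
  simp only [cubic, oddCubic]; push_cast; ring

/-- The points with orbit in `[-√(s + 1), √(s + 1)]` under the odd cubic. -/
def trapped (s : ℝ) : Set ℝ := {u | ∀ n, (oddCubic s)^[n] u ^ 2 ≤ s + 1}

lemma oddCubic_mem_trapped {s u : ℝ} (hu : u ∈ trapped s) : oddCubic s u ∈ trapped s :=
  fun n => by rw [← Function.iterate_succ_apply]; exact hu (n + 1)

/-- The odd cubic expands the arcsine metric of `[-√(s + 1), √(s + 1)]` by a factor `3`. -/
lemma nine_mul_lt {s u : ℝ} (hs : 3 < s) (hu : u ^ 2 < s + 1) :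
    9 * (s + 1 - oddCubic s u ^ 2) < (s - 3 * u ^ 2) ^ 2 * (s + 1 - u ^ 2) := by
  have key : (s - 3 * u ^ 2) ^ 2 * (s + 1 - u ^ 2) - 9 * (s + 1 - oddCubic s u ^ 2) =
      (s + 1 - u ^ 2) * ((3 * s - 9) * u ^ 2 + (s ^ 2 - 9)) := by
    rw [oddCubic]; ring
  have h2 : 0 < (3 * s - 9) * u ^ 2 + (s ^ 2 - 9) := by nlinarith [sq_nonneg u]
  nlinarith [mul_pos (sub_pos.2 hu) h2]

lemma hasDerivAt_oddCubic (s u : ℝ) : HasDerivAt (oddCubic s) (s - 3 * u ^ 2) u := by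
  have := ((hasDerivAt_id u).const_mul s).sub (hasDerivAt_pow 3 u)
  simpa [oddCubic] using! this

lemma hasDerivAt_arcsin_div {D u : ℝ} (hu : u ^ 2 < D) :
    HasDerivAt (fun x => Real.arcsin (x / √D)) (1 / √(D - u ^ 2)) u := by
  have hD : 0 < D := (sq_nonneg u).trans_lt hu
  have hsq : 0 < √D := Real.sqrt_pos.2 hD
  have hlt : (u / √D) ^ 2 < 1 := by
    rw [div_pow, Real.sq_sqrt hD.le, div_lt_one hD]; exact hu
  have habs := abs_lt.1 ((sq_lt_one_iff_abs_lt_one _).1 hlt)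
  have h := (Real.hasDerivAt_arcsin habs.1.ne' habs.2.ne).comp u ((hasDerivAt_id u).div_const √D)
  convert! h using 1
  rw [div_pow, Real.sq_sqrt hD.le, show 1 - u ^ 2 / D = (D - u ^ 2) / D by field_simp,
    Real.sqrt_div' _ hD.le]
  have : 0 < √(D - u ^ 2) := Real.sqrt_pos.2 (sub_pos.2 hu)
  field_simp

lemma three_mul_abs_arcsin_sub_le {s x y : ℝ} (hs : 3 < s) (hxy : x < y)
    (h : Icc x y ⊆ trapped s) :
    3 * |Real.arcsin (y / √(s + 1)) - Real.arcsin (x / √(s + 1))| ≤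
      |Real.arcsin (oddCubic s y / √(s + 1)) - Real.arcsin (oddCubic s x / √(s + 1))| := by
  have hIoo : ∀ u ∈ Ioo x y, u ^ 2 < s + 1 := by
    intro u hu
    have hx : x ^ 2 ≤ s + 1 := h (left_mem_Icc.2 hxy.le) 0
    have hy : y ^ 2 ≤ s + 1 := h (right_mem_Icc.2 hxy.le) 0
    nlinarith [hu.1, hu.2, mul_pos (sub_pos.2 hu.1) (sub_pos.2 hu.2)]
  have hIoo' : ∀ u ∈ Ioo x y, oddCubic s u ^ 2 < s + 1 := by
    intro u hu
    have hle : ∀ v ∈ Icc x y, oddCubic s v ^ 2 ≤ s + 1 := fun v hv => h hv 1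
    refine lt_of_le_of_ne (hle u (Ioo_subset_Icc_self hu)) fun heq => ?_
    have hmax : IsLocalMax (fun v => oddCubic s v ^ 2) u := by
      filter_upwards [Icc_mem_nhds hu.1 hu.2] with v hv
      rw [heq]; exact hle v hv
    have hd := hmax.hasDerivAt_eq_zero ((hasDerivAt_oddCubic s u).pow 2)
    have h1 := nine_mul_lt hs (hIoo u hu)
    have h0 : oddCubic s u ≠ 0 := fun h0 => by rw [h0] at heq; nlinarith
    have h2 : s - 3 * u ^ 2 = 0 := by simpa [h0] using hd
    rw [h2, heq] at h1
    simp at h1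
  obtain ⟨u, hu, heq⟩ := exists_ratio_hasDerivAt_eq_ratio_slope
    (fun v => Real.arcsin (oddCubic s v / √(s + 1)))
    (fun v => 1 / √(s + 1 - oddCubic s v ^ 2) * (s - 3 * v ^ 2)) hxy
    ((Real.continuous_arcsin.comp ((continuous_oddCubic s).div_const _)).continuousOn)
    (fun v hv => (hasDerivAt_arcsin_div (hIoo' v hv)).comp v (hasDerivAt_oddCubic s v))
    (fun v => Real.arcsin (v / √(s + 1))) (fun v => 1 / √(s + 1 - v ^ 2))
    ((Real.continuous_arcsin.comp (continuous_id.div_const _)).continuousOn)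
    (fun v hv => hasDerivAt_arcsin_div (hIoo v hv))
  have hp : 0 < s + 1 - u ^ 2 := sub_pos.2 (hIoo u hu)
  have hq : 0 < s + 1 - oddCubic s u ^ 2 := sub_pos.2 (hIoo' u hu)
  have hP := Real.sqrt_pos.2 hp
  have hQ := Real.sqrt_pos.2 hq
  have hlt : 3 * √(s + 1 - oddCubic s u ^ 2) ≤ |s - 3 * u ^ 2| * √(s + 1 - u ^ 2) := by
    refine le_of_sq_le_sq ?_ (by positivity)
    rw [mul_pow, mul_pow, Real.sq_sqrt hq.le, Real.sq_sqrt hp.le, sq_abs]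
    linarith [nine_mul_lt hs (hIoo u hu)]
  have habs := congrArg abs heq
  rw [abs_mul, abs_mul, abs_mul, abs_of_pos (one_div_pos.2 hP), abs_of_pos (one_div_pos.2 hQ)]
    at habs
  field_simp at habs
  refine le_of_mul_le_mul_right ?_ hQ
  rw [mul_comm |Real.arcsin (oddCubic s y / _) - _|, ← habs]
  nlinarith [abs_nonneg (Real.arcsin (y / √(s + 1)) - Real.arcsin (x / √(s + 1)))]

lemma pow_three_mul_abs_arcsin_sub_le {s : ℝ} (hs : 3 < s) (n : ℕ) :
    ∀ {x y : ℝ}, uIcc x y ⊆ trapped s →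
      3 ^ n * |Real.arcsin (y / √(s + 1)) - Real.arcsin (x / √(s + 1))| ≤ Real.pi := by
  induction n with
  | zero =>
    intro x y _
    rw [pow_zero, one_mul, abs_le]
    constructor <;>
    linarith [Real.arcsin_le_pi_div_two (y / √(s + 1)), Real.arcsin_le_pi_div_two (x / √(s + 1)),
      Real.neg_pi_div_two_le_arcsin (y / √(s + 1)), Real.neg_pi_div_two_le_arcsin (x / √(s + 1))]
  | succ n ih =>
    intro x y h
    have hstep : 3 * |Real.arcsin (y / √(s + 1)) - Real.arcsin (x / √(s + 1))| ≤
        |Real.arcsin (oddCubic s y / √(s + 1)) - Real.arcsin (oddCubic s x / √(s + 1))| := by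
      rcases lt_trichotomy x y with hxy | rfl | hxy
      · exact three_mul_abs_arcsin_sub_le hs hxy (uIcc_of_le hxy.le ▸ h)
      · simp
      · rw [abs_sub_comm, abs_sub_comm (Real.arcsin (oddCubic s y / √(s + 1)))]
        exact three_mul_abs_arcsin_sub_le hs hxy (uIcc_of_ge hxy.le ▸ h)
    have himg : uIcc (oddCubic s x) (oddCubic s y) ⊆ trapped s := by
      refine (intermediate_value_uIcc (continuous_oddCubic s).continuousOn).trans ?_
      rintro _ ⟨v, hv, rfl⟩
      exact oddCubic_mem_trapped (h hv)
    have h3 : (0 : ℝ) < 3 ^ n := by positivity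
    rw [pow_succ, mul_assoc]
    exact (mul_le_mul_of_nonneg_left hstep h3.le).trans (ih himg)

lemma not_Icc_subset_trapped {s x y : ℝ} (hs : 3 < s) (hxy : x < y) : ¬ Icc x y ⊆ trapped s := by
  intro h
  have hsq : 0 < √(s + 1) := Real.sqrt_pos.2 (by linarith)
  have hbd : ∀ u ∈ Icc x y, u / √(s + 1) ∈ Icc (-1 : ℝ) 1 := fun u hu => by
    have h1 : u ^ 2 ≤ s + 1 := h hu 0
    rw [mem_Icc, ← abs_le, ← sq_le_one_iff_abs_le_one, div_pow, Real.sq_sqrt (by linarith)]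
    exact (div_le_one (by linarith)).2 h1
  have hlt := Real.strictMonoOn_arcsin (hbd x (left_mem_Icc.2 hxy.le))
    (hbd y (right_mem_Icc.2 hxy.le)) (div_lt_div_of_pos_right hxy hsq)
  have hpos : 0 < |Real.arcsin (y / √(s + 1)) - Real.arcsin (x / √(s + 1))| :=
    abs_pos.2 (sub_pos.2 hlt).ne'
  obtain ⟨n, hn⟩ := pow_unbounded_of_one_lt
    (Real.pi / |Real.arcsin (y / √(s + 1)) - Real.arcsin (x / √(s + 1))|)
    (by norm_num : (1 : ℝ) < 3)
  rw [div_lt_iff₀ hpos] at hn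
  exact absurd (pow_three_mul_abs_arcsin_sub_le hs n (uIcc_of_le hxy.le ▸ h)) (not_le.2 hn)

lemma mem_trapped_of_neg_sq_mem {s u : ℝ} (hs : 3 ≤ s)
    (hu : ((-u ^ 2 : ℝ) : ℂ) ∈ filledJulia (cubic s)) : u ∈ trapped s := by
  intro n
  have hmem : (cubic s)^[n] ((-u ^ 2 : ℝ) : ℂ) ∈ filledJulia (cubic s) := by
    rw [mem_filledJulia_cubic_iff (by linarith)] at hu ⊢
    intro m
    rw [← Function.iterate_add_apply]
    exact hu _
  have h := filledJulia_cubic_subset_spine hs hmem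
  rw [← (semiconj_oddCubic s).iterate_right n u, mem_spine_iff, Complex.ofReal_re] at h
  linarith [h.1]

theorem isTotallyDisconnected_filledJulia_cubic {s : ℝ} (hs : 3 < s) :
    IsTotallyDisconnected (filledJulia (cubic s)) := by
  have hre : IsTotallyDisconnected {x : ℝ | (x : ℂ) ∈ filledJulia (cubic s)} := by
    rw [isTotallyDisconnected_iff_lt]
    intro x hx y hy hxy
    by_contra! hcon
    have hall : ∀ z ∈ Icc x y, (z : ℂ) ∈ filledJulia (cubic s) := fun z hz => by
      rcases hz.1.eq_or_lt with rfl | h1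
      · exact hx
      rcases hz.2.eq_or_lt with rfl | h2
      · exact hy
      by_contra hz'
      exact hcon z hz' ⟨h1, h2⟩
    have hy0 : y ≤ 0 := by
      simpa using (mem_spine_iff.1 (filledJulia_cubic_subset_spine hs.le hy)).2.1
    refine not_Icc_subset_trapped hs
      (Real.sqrt_lt_sqrt (by linarith : 0 ≤ -y) (by linarith : -y < -x)) fun u hu => ?_
    apply mem_trapped_of_neg_sq_mem hs.le
    have hu0 : 0 ≤ u := (Real.sqrt_nonneg _).trans hu.1
    have h1 := (Real.sqrt_le_left hu0).1 hu.1
    have h2 := (Real.le_sqrt hu0 (by linarith)).1 hu.2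
    exact hall _ ⟨by linarith, by linarith⟩
  have himg := (Complex.isometry_ofReal.isEmbedding.isTotallyDisconnected_image).2 hre
  intro t ht
  refine himg t fun w hw => ?_
  have h := mem_spine_iff.1 (filledJulia_cubic_subset_spine hs.le (ht hw))
  have hw' : w = (w.re : ℂ) := Complex.ext (by simp) (by simp [h.2.2])
  exact ⟨w.re, show ((w.re : ℝ) : ℂ) ∈ _ from hw' ▸ ht hw, hw'.symm⟩

lemma filledJulia_eq_preimage {P : ℂ → ℂ} {s r : ℝ} (hr : 0 < r)
    (hP : ∀ z, P z = z * (s + r * z) ^ 2) :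
    filledJulia P = (fun z : ℂ => (r : ℂ) * z) ⁻¹' filledJulia (cubic s) := by
  have hsemi : Function.Semiconj (fun z : ℂ => (r : ℂ) * z) P (cubic s) := fun z => by
    simp only [hP, cubic]; ring
  ext z
  change Bornology.IsBounded (range fun n => P^[n] z) ↔
    Bornology.IsBounded (range fun n => (cubic s)^[n] ((r : ℂ) * z))
  simp only [← (hsemi.iterate_right _).eq]
  simp only [isBounded_iff_forall_norm_le, forall_mem_range, norm_mul, Complex.norm_real,
    Real.norm_of_nonneg hr.le]
  constructor
  · rintro ⟨C, hC⟩
    exact ⟨r * C, fun n => mul_le_mul_of_nonneg_left (hC n) hr.le⟩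
  · rintro ⟨C, hC⟩
    exact ⟨C / r, fun n => (le_div_iff₀' hr).2 (hC n)⟩

lemma frontier_filledJulia_eq_preimage {P : ℂ → ℂ} {s r : ℝ} (hr : 0 < r)
    (hP : ∀ z, P z = z * (s + r * z) ^ 2) :
    frontier (filledJulia P) =
      Homeomorph.mulLeft₀ (r : ℂ) (by exact_mod_cast hr.ne') ⁻¹'
        frontier (filledJulia (cubic s)) := by
  rw [Homeomorph.preimage_frontier, filledJulia_eq_preimage hr hP]
  rfl

end PerfectSquareCubic

/-- For a finite simple graph with independence number 3 whose reduced
independence polynomial is `P(z) = a₁z + a₂z² + a₃z³`, suppose `a₂² = 4·a₁·a₃`. Then the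
Julia set of `P` is connected for `a₁ ≤ 9`; for `a₁ = 9` it equals the real segment
`[δ₁, 0]` with `δ₁ = −(1+√a₁)/√a₃`; and for `a₁ > 9` it is totally disconnected. -/
theorem stmt_10 {V : Type*} [Fintype V] [DecidableEq V]
    (G : SimpleGraph V) [DecidableRel G.Adj]
    (a₁ a₂ a₃ : ℕ)
    (ha₁ : a₁ = Fintype.card V)
    (ha₂ : a₂ = (Finset.univ.filter
      (fun s : Finset V => s.card = 2 ∧ ∀ u ∈ s, ∀ v ∈ s, ¬ G.Adj u v)).card)
    (ha₃ : a₃ = (Finset.univ.filter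
      (fun s : Finset V => s.card = 3 ∧ ∀ u ∈ s, ∀ v ∈ s, ¬ G.Adj u v)).card)
    (hindep3 : ∃ s : Finset V, s.card = 3 ∧ ∀ u ∈ s, ∀ v ∈ s, ¬ G.Adj u v)
    (hindep4 : ¬ ∃ s : Finset V, s.card = 4 ∧ ∀ u ∈ s, ∀ v ∈ s, ¬ G.Adj u v)
    (P : ℂ → ℂ)
    (hP : ∀ z, P z = a₁ * z + a₂ * z ^ 2 + a₃ * z ^ 3)
    (hcond : a₂ ^ 2 = 4 * a₁ * a₃) :
    (a₁ ≤ 9 →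
      IsConnected
        (frontier {z : ℂ | Bornology.IsBounded (Set.range fun n => P^[n] z)})) ∧
    (a₁ = 9 →
      frontier {z : ℂ | Bornology.IsBounded (Set.range fun n => P^[n] z)}
        = (fun x : ℝ => (x : ℂ)) ''
            Set.Icc (-(1 + Real.sqrt a₁) / Real.sqrt a₃) 0) ∧
    (9 < a₁ →
      IsTotallyDisconnected
        (frontier {z : ℂ | Bornology.IsBounded (Set.range fun n => P^[n] z)})) := by
  have hcard : 3 ≤ a₁ ∧ 1 ≤ a₃ := by
    obtain ⟨t, ht, hti⟩ := hindep3
    refine ⟨ha₁ ▸ ht ▸ t.card_le_univ, ?_⟩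
    rw [ha₃, Nat.one_le_iff_ne_zero, Finset.card_ne_zero]
    exact ⟨t, Finset.mem_filter.2 ⟨Finset.mem_univ _, ht, hti⟩⟩
  have ha₁0 : (0 : ℝ) < a₁ := by exact_mod_cast (by omega : 0 < a₁)
  have ha₃0 : (0 : ℝ) < a₃ := by exact_mod_cast (by omega : 0 < a₃)
  have hs : 0 < √(a₁ : ℝ) := Real.sqrt_pos.2 ha₁0
  have hr : 0 < √(a₃ : ℝ) := Real.sqrt_pos.2 ha₃0
  have h2 : (a₂ : ℝ) = 2 * √(a₁ : ℝ) * √(a₃ : ℝ) := by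
    refine (pow_left_inj₀ (by positivity) (by positivity) two_ne_zero).1 ?_
    rw [mul_pow, mul_pow, Real.sq_sqrt ha₁0.le, Real.sq_sqrt ha₃0.le]
    have : (a₂ : ℝ) ^ 2 = 4 * a₁ * a₃ := by exact_mod_cast hcond
    linarith
  have hP' : ∀ z, P z = z * ((√(a₁ : ℝ) : ℝ) + (√(a₃ : ℝ) : ℝ) * z) ^ 2 := fun z => by
    have e1 : ((√(a₁ : ℝ) : ℝ) : ℂ) ^ 2 = a₁ := by
      rw [← Complex.ofReal_pow, Real.sq_sqrt ha₁0.le]; simp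
    have e3 : ((√(a₃ : ℝ) : ℝ) : ℂ) ^ 2 = a₃ := by
      rw [← Complex.ofReal_pow, Real.sq_sqrt ha₃0.le]; simp
    have e2 : (a₂ : ℂ) = 2 * (√(a₁ : ℝ) : ℝ) * (√(a₃ : ℝ) : ℝ) := by
      exact_mod_cast congrArg Complex.ofReal h2
    rw [hP, e2, ← e1, ← e3]; ring
  have hJ := PerfectSquareCubic.frontier_filledJulia_eq_preimage hr hP'
  change (_ → IsConnected (frontier (PerfectSquareCubic.filledJulia P))) ∧
    (_ → frontier (PerfectSquareCubic.filledJulia P) = _) ∧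
    (_ → IsTotallyDisconnected (frontier (PerfectSquareCubic.filledJulia P)))
  rw [hJ]
  refine ⟨fun h => ?_, fun h => ?_, fun h => ?_⟩
  · rw [Homeomorph.isConnected_preimage]
    refine PerfectSquareCubic.isConnected_frontier_filledJulia_cubic hs ?_
    rw [Real.sqrt_le_left (by norm_num)]
    have : (a₁ : ℝ) ≤ 9 := by exact_mod_cast h
    linarith
  · have h3 : √(a₁ : ℝ) = 3 := by
      rw [h, Real.sqrt_eq_iff_mul_self_eq (by norm_num) (by norm_num)]; norm_num
    rw [h3, PerfectSquareCubic.frontier_filledJulia_cubic_three]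
    have hr' : ((√(a₃ : ℝ) : ℝ) : ℂ) ≠ 0 := by exact_mod_cast hr.ne'
    ext z
    constructor
    · rintro ⟨x, ⟨hx1, hx2⟩, hx⟩
      have hx' : (x : ℂ) = ((√(a₃ : ℝ) : ℝ) : ℂ) * z := hx
      refine ⟨x / √(a₃ : ℝ), ⟨?_, div_nonpos_of_nonpos_of_nonneg hx2 hr.le⟩, ?_⟩
      · exact div_le_div_of_nonneg_right (by linarith) hr.le
      · push_cast
        rw [hx', mul_div_cancel_left₀ _ hr']
    · rintro ⟨x, ⟨hx1, hx2⟩, rfl⟩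
      refine ⟨√(a₃ : ℝ) * x, ⟨?_, mul_nonpos_of_nonneg_of_nonpos hr.le hx2⟩, ?_⟩
      · rw [div_le_iff₀ hr] at hx1; linarith
      · simp
  · have h3 : 3 < √(a₁ : ℝ) := by
      rw [Real.lt_sqrt (by norm_num)]
      have : (9 : ℝ) < a₁ := by exact_mod_cast h
      linarith
    have hr' : ((√(a₃ : ℝ) : ℝ) : ℂ) ≠ 0 := by exact_mod_cast hr.ne'
    refine (Homeomorph.mulLeft₀ _ hr').isEmbedding.isTotallyDisconnected ?_
    rw [Set.image_preimage_eq _ (Homeomorph.surjective _),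
      PerfectSquareCubic.frontier_eq_self_of_subset_spine
        (PerfectSquareCubic.isClosed_filledJulia_cubic hs)
        (PerfectSquareCubic.filledJulia_cubic_subset_spine h3.le)]
    exact PerfectSquareCubic.isTotallyDisconnected_filledJulia_cubic h3
end
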